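/- arXiv:math/0207192 — 2 statements merged into one kernel-verified Lean document; each statement's English description precedes it below -/
import Mathlib

section
/- Let k ≥ 4 and 2 ≤ d ≤ k−2. Then for every n ≥ k, Σ_{j=0}^{k−1} (−1)^j binom(k−1−j, j) x_{k,d}^2(n−j) = Σ_{j=0}^{k−1} (−1)^j binom(k−1−j, j) x_{k,d}^2(n−1−j) + Σ_{j=0}^{k−4} (−1)^j binom(k−4−j, j) x_{k,d}^2(n−3−j), and for every n with 0 ≤ n ≤ k−1, x_{k,d}^2(n) = binom(2n, n)/(n+1), the n-th Catalan number. (Here binom(a,b) denotes the binomial coefficient, equal to 0 when b > a.) -/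
/-- A permutation `α` of `{1,…,n}` (as `Equiv.Perm (Fin n)`, 0-indexed) contains the
pattern given in one-line notation by the list `w`: there are increasing positions
whose values are order-isomorphic to `w`. -/
def ContainsPattern {n : ℕ} (α : Equiv.Perm (Fin n)) (w : List ℕ) : Prop :=
  ∃ f : Fin w.length → Fin n, StrictMono f ∧
    ∀ a b : Fin w.length, w.get a < w.get b ↔ α (f a) < α (f b)

/-- `α` avoids the pattern `w`. -/
def AvoidsPattern {n : ℕ} (α : Equiv.Perm (Fin n)) (w : List ℕ) : Prop :=
  ¬ ContainsPattern α w


/-- The length-`k` pattern `(d+1)(d+2)⋯(k−1) 1 k 2 3 ⋯ d`. -/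
def X2patA (k d : ℕ) : List ℕ :=
  List.range' (d+1) (k-1-d) ++ [1, k] ++ List.range' 2 (d-1)

/-- The length-`k` pattern `(d+1)(d+2)⋯(k−1) k 1 2 ⋯ d`. -/
def X2patB (k d : ℕ) : List ℕ :=
  List.range' (d+1) (k-1-d) ++ [k] ++ List.range' 1 d

/-- `x_{k,d}^2(n)`: the number of permutations of `{1,…,n}` avoiding every pattern in
`X_{k,d}^2 = {321, (d+1)⋯(k−1) 1 k 2 3 ⋯ d, (d+1)⋯(k−1) k 1 2 ⋯ d}`. -/
noncomputable def x2 (k d n : ℕ) : ℕ :=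
  Nat.card {π : Equiv.Perm (Fin n) //
    AvoidsPattern π [3,2,1] ∧ AvoidsPattern π (X2patA k d) ∧ AvoidsPattern π (X2patB k d)}

section GeneratingFunctions

open PowerSeries Finset

/-- The polynomial `∑ j, (-1)^j * C(m-j, j) * X^j`, a rescaled Chebyshev polynomial of the second
kind, as a power series. -/
noncomputable def chebSeries (m : ℕ) : ℤ⟦X⟧ :=
  PowerSeries.mk fun j => (-1) ^ j * ((m - j).choose j : ℤ)

/-- The denominators of the generating functions of `x2`. -/
noncomputable def denomSeries (m : ℕ) : ℤ⟦X⟧ :=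
  chebSeries (m + 2) + X ^ 2 * chebSeries m

theorem chebSeries_add_two (m : ℕ) :
    chebSeries (m + 2) = chebSeries (m + 1) - X * chebSeries m := by
  ext n
  rcases n with _ | n
  · simp [chebSeries]
  · simp only [chebSeries, map_sub, coeff_mk, coeff_succ_X_mul]
    have e1 : m + 1 - (n + 1) = m - n := by omega
    rw [e1]
    rcases le_or_gt n m with h | h
    · have e2 : m + 2 - (n + 1) = (m - n) + 1 := by omega
      rw [e2, Nat.choose_succ_succ]
      push_cast
      ring
    · have e2 : m + 2 - (n + 1) = 0 := by omega
      have e3 : m - n = 0 := by omega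
      rw [e2, e3, Nat.choose_eq_zero_of_lt (show 0 < n + 1 by omega),
        Nat.choose_eq_zero_of_lt (show 0 < n by omega)]
      simp

theorem denomSeries_add_two (m : ℕ) :
    denomSeries (m + 2) = denomSeries (m + 1) - X * denomSeries m := by
  simp only [denomSeries]
  rw [chebSeries_add_two (m + 2), chebSeries_add_two m]
  ring

theorem chebSeries_zero : chebSeries 0 = 1 := by
  ext n
  rcases n with _ | n <;> simp [chebSeries]

theorem chebSeries_one : chebSeries 1 = 1 := by
  ext n
  rcases n with _ | n <;> simp [chebSeries]

theorem coeff_denomSeries_eq_zero {m n : ℕ} (h : m + 2 < n) : coeff n (denomSeries m) = 0 := by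
  obtain ⟨n, rfl⟩ : ∃ i, n = i + 2 := ⟨n - 2, by omega⟩
  simp only [denomSeries, map_add, coeff_X_pow_mul, chebSeries, coeff_mk]
  rw [Nat.choose_eq_zero_of_lt (by omega), Nat.choose_eq_zero_of_lt (by omega)]
  simp

theorem denomSeries_eq (m : ℕ) :
    denomSeries (m + 2) = (1 - X) * chebSeries (m + 3) - X ^ 3 * chebSeries m := by
  simp only [denomSeries]
  rw [chebSeries_add_two (m + 2), chebSeries_add_two (m + 1), chebSeries_add_two m]
  ring

/-- `f` has generating function `denomSeries m / denomSeries (m + 1)` and starts with the Catalan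
numbers. -/
def IsChebQuotient (f : ℕ → ℕ) (m : ℕ) : Prop :=
  PowerSeries.mk (fun n => (f n : ℤ)) * denomSeries (m + 1) = denomSeries m ∧
    ∀ n ≤ m + 2, f n = catalan n

theorem IsChebQuotient.succ {f g : ℕ → ℕ} {m : ℕ} (hf : IsChebQuotient f m) (h0 : g 0 = 1)
    (hg : ∀ n, g (n + 1) = ∑ ij ∈ antidiagonal n, f ij.1 * g ij.2) :
    IsChebQuotient g (m + 1) := by
  obtain ⟨hf1, hf2⟩ := hf
  constructor
  · have key : PowerSeries.mk (fun n => (g n : ℤ)) =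
        1 + X * (PowerSeries.mk (fun n => (f n : ℤ)) * PowerSeries.mk (fun n => (g n : ℤ))) := by
      ext n
      rcases n with _ | n
      · simp [h0]
      · rw [map_add, coeff_succ_X_mul, coeff_mul]
        simp [hg, coeff_one]
    rw [denomSeries_add_two]
    set F := PowerSeries.mk (fun n => (f n : ℤ))
    set G := PowerSeries.mk (fun n => (g n : ℤ))
    linear_combination denomSeries (m + 1) * key + X * G * hf1
  · intro n
    induction n using Nat.strong_induction_on with
    | _ n ih =>
      intro hn
      rcases n with _ | n
      · simp [h0]
      · rw [hg, catalan_succ']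
        refine sum_congr rfl fun ij hij => ?_
        rw [HasAntidiagonal.mem_antidiagonal] at hij
        rw [hf2 _ (by omega), ih _ (by omega) (by omega)]

theorem isChebQuotient_zero {f : ℕ → ℕ} (h0 : f 0 = 1) (hf : ∀ n, f (n + 1) = n + 1) :
    IsChebQuotient f 0 := by
  constructor
  · have e1 : denomSeries 1 = (1 - X) ^ 2 := by
      rw [denomSeries, chebSeries_add_two 1, chebSeries_add_two 0, zero_add, chebSeries_one,
        chebSeries_zero]
      ring
    have e0 : denomSeries 0 = 1 - X + X ^ 2 := by
      rw [denomSeries, chebSeries_add_two 0, zero_add, chebSeries_one, chebSeries_zero]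
      ring
    have e2 : PowerSeries.mk (fun n => (f n : ℤ)) * (1 - X) =
        1 + X ^ 2 * PowerSeries.mk (fun _ => (1 : ℤ)) := by
      ext n
      rw [mul_sub, mul_one, map_sub]
      rcases n with _ | _ | n
      · simp [h0]
      · rw [coeff_succ_mul_X]
        simp [h0, hf, coeff_X_pow_mul', coeff_one]
      · rw [coeff_succ_mul_X, map_add, show n + 1 + 1 = n + 2 from rfl, coeff_X_pow_mul]
        simp [hf, coeff_one]
    have e3 : PowerSeries.mk (fun _ => (1 : ℤ)) * (1 - X) = 1 := by
      exact PowerSeries.mk_one_mul_one_sub_eq_one ℤ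
    rw [zero_add, e1, e0]
    linear_combination (1 - X) * e2 + X ^ 2 * e3
  · intro n hn
    interval_cases n
    · simp [h0]
    · simp [hf]
    · simp [hf, catalan_two]

theorem coeff_mul_chebSeries (f : ℕ → ℤ) {m n : ℕ} (h : m ≤ n) :
    coeff n (PowerSeries.mk f * chebSeries m) =
      ∑ j ∈ range (m + 1), (-1 : ℤ) ^ j * ((m - j).choose j : ℤ) * f (n - j) := by
  rw [mul_comm, coeff_mul, Nat.sum_antidiagonal_eq_sum_range_succ_mk]
  simp only [chebSeries, coeff_mk]
  symm
  refine sum_subset (range_subset_range.2 (by omega)) fun j _ hj => ?_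
  rw [Finset.mem_range, not_lt] at hj
  rw [Nat.choose_eq_zero_of_lt (by omega)]
  simp

theorem IsChebQuotient.recurrence {f : ℕ → ℕ} {m n : ℕ} (hf : IsChebQuotient f (m + 1))
    (hn : m + 4 ≤ n) :
    ∑ j ∈ range (m + 4), (-1 : ℤ) ^ j * ((m + 3 - j).choose j : ℤ) * (f (n - j) : ℤ) =
      (∑ j ∈ range (m + 4), (-1 : ℤ) ^ j * ((m + 3 - j).choose j : ℤ) * (f (n - 1 - j) : ℤ)) +
        ∑ j ∈ range (m + 1), (-1 : ℤ) ^ j * ((m - j).choose j : ℤ) * (f (n - 3 - j) : ℤ) := by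
  obtain ⟨n, rfl⟩ : ∃ i, n = i + 3 := ⟨n - 3, by omega⟩
  have h := congrArg (coeff (n + 3)) hf.1
  rw [coeff_denomSeries_eq_zero (by omega), denomSeries_eq] at h
  set F := PowerSeries.mk (fun n => (f n : ℤ)) with hF
  have e : F * ((1 - X) * chebSeries (m + 3) - X ^ 3 * chebSeries m) =
      F * chebSeries (m + 3) - X * (F * chebSeries (m + 3)) - X ^ 3 * (F * chebSeries m) := by
    ring
  rw [e, map_sub, map_sub, coeff_succ_X_mul, coeff_X_pow_mul, hF,
    coeff_mul_chebSeries _ (by omega), coeff_mul_chebSeries _ (by omega),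
    coeff_mul_chebSeries _ (by omega)] at h
  simp only [Nat.add_sub_cancel, show n + 3 - 1 = n + 2 from rfl]
  linarith

end GeneratingFunctions

section Envelopes

open Finset

/-- The sequences `M 0 ≤ M 1 ≤ ⋯ ≤ M (n - 1) = n` with `i < M i`. -/
def IsEnvelope (n : ℕ) (M : ℕ → ℕ) : Prop :=
  (∀ i < n, i + 1 ≤ M i ∧ M i ≤ n) ∧ ∀ i j, i ≤ j → j < n → M i ≤ M j

/-- The number of positions up to `i` at which `M` jumps to a new value. -/
def jumps (M : ℕ → ℕ) (i : ℕ) : ℕ :=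
  #{j ∈ range (i + 1) | j = 0 ∨ M (j - 1) < M j}

/-- The condition on the envelope of a `321`-avoiding permutation that characterizes the occurrence
of one of the two long patterns, see `hasConfig_iff_containsShape`. -/
def ContainsShape (n p d : ℕ) (M : ℕ → ℕ) : Prop :=
  ∃ i j l, i < n ∧ j < n ∧ l < n ∧ jumps M i + p ≤ jumps M j + 1 ∧ jumps M j + 1 ≤ jumps M l ∧
    j + 1 + jumps M i + d ≤ M i + jumps M j ∧ l + jumps M i + d ≤ M i + jumps M l

theorem jumps_zero (M : ℕ → ℕ) : jumps M 0 = 1 := by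
  simp [jumps, filter_singleton]

theorem jumps_succ (M : ℕ → ℕ) (i : ℕ) :
    jumps M (i + 1) = jumps M i + if M i < M (i + 1) then 1 else 0 := by
  rw [jumps, range_add_one, filter_insert]
  by_cases h : M i < M (i + 1)
  · rw [if_pos (Or.inr (by simpa using h)), if_pos h, card_insert_of_notMem (by simp), jumps]
  · rw [if_neg (by simpa using h), if_neg h, jumps, add_zero]

theorem jumps_mono (M : ℕ → ℕ) : Monotone (jumps M) :=
  monotone_nat_of_le_succ fun i => by rw [jumps_succ]; omega

theorem jumps_pos (M : ℕ → ℕ) (i : ℕ) : 1 ≤ jumps M i := by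
  have := jumps_mono M (Nat.zero_le i)
  rwa [jumps_zero] at this

theorem jumps_le (M : ℕ → ℕ) (i : ℕ) : jumps M i ≤ i + 1 := by
  induction i with
  | zero => rw [jumps_zero]
  | succ i ih => rw [jumps_succ]; split_ifs <;> omega

theorem jumps_congr {M M' : ℕ → ℕ} {i : ℕ} (h : ∀ j ≤ i, M j = M' j) : jumps M i = jumps M' i := by
  induction i with
  | zero => simp only [jumps_zero]
  | succ i ih =>
    rw [jumps_succ, jumps_succ, ih fun j hj => h j (by omega), h i (by omega), h (i + 1) le_rfl]

theorem containsShape_congr {n p d : ℕ} {M M' : ℕ → ℕ} (h : ∀ i < n, M i = M' i) :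
    ContainsShape n p d M ↔ ContainsShape n p d M' := by
  have hj : ∀ i < n, jumps M i = jumps M' i := fun i hi => jumps_congr fun j hj => h j (by omega)
  constructor
  · rintro ⟨i, j, l, hi, hj', hl, H⟩
    refine ⟨i, j, l, hi, hj', hl, ?_⟩
    rwa [← hj i hi, ← hj j hj', ← hj l hl, ← h i hi]
  · rintro ⟨i, j, l, hi, hj', hl, H⟩
    refine ⟨i, j, l, hi, hj', hl, ?_⟩
    rwa [hj i hi, hj j hj', hj l hl, h i hi]

namespace IsEnvelope

variable {n : ℕ} {M : ℕ → ℕ}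

theorem add_jumps_le (hM : IsEnvelope n M) {i j : ℕ} (hij : i ≤ j) (hj : j < n) :
    M i + jumps M j ≤ M j + jumps M i := by
  induction j, hij using Nat.le_induction with
  | base => rfl
  | succ j hij ih =>
    have := ih (by omega)
    have := hM.2 j (j + 1) (by omega) hj
    rw [jumps_succ]
    split_ifs <;> omega

theorem jumps_lt_iff (hM : IsEnvelope n M) {i j : ℕ} (hi : i < n) (hj : j < n) :
    jumps M i < jumps M j ↔ M i < M j := by
  constructor
  · intro h
    have hij : i ≤ j := by
      by_contra! h'
      have := jumps_mono M h'.le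
      omega
    have := hM.add_jumps_le hij hj
    omega
  · intro h
    have hij : i ≤ j := by
      by_contra! h'
      have := hM.2 j i h'.le hi
      omega
    clear hi
    induction j, hij using Nat.le_induction with
    | base => omega
    | succ j hij ih =>
      have := jumps_mono M hij
      rw [jumps_succ]
      split_ifs with h'
      · omega
      · have := ih (by omega) (by omega)
        omega

theorem apply_last (hM : IsEnvelope (n + 1) M) : M n = n + 1 := by
  have := hM.1 n (by omega)
  omega

end IsEnvelope

/-- The envelope whose first return to the diagonal is at `a`, built from an envelope `A` of size
`a` for the part before it and an envelope `B` for the part after it. -/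
def glue (a : ℕ) (A B : ℕ → ℕ) (i : ℕ) : ℕ :=
  if i < a then A i + 1 else if i = a then a + 1 else B (i - a - 1) + a + 1

section Glue

variable {a b : ℕ} {A B : ℕ → ℕ}

theorem glue_of_lt {i : ℕ} (h : i < a) : glue a A B i = A i + 1 := by simp [glue, h]

theorem glue_self : glue a A B a = a + 1 := by simp [glue]

theorem glue_add (i : ℕ) : glue a A B (a + 1 + i) = B i + a + 1 := by
  rw [glue, if_neg (by omega), if_neg (by omega), show a + 1 + i - a - 1 = i by omega]

theorem isEnvelope_glue (hA : IsEnvelope a A) (hB : IsEnvelope b B) :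
    IsEnvelope (a + b + 1) (glue a A B) := by
  constructor
  · intro i hi
    rcases lt_trichotomy i a with h | rfl | h
    · rw [glue_of_lt h]
      have := hA.1 i h
      omega
    · rw [glue_self]
      omega
    · obtain ⟨i, rfl⟩ := Nat.exists_eq_add_of_le h
      rw [Nat.succ_eq_add_one, glue_add]
      have := hB.1 i (by omega)
      omega
  · intro i j hij hj
    rcases lt_trichotomy j a with h | rfl | h
    · rw [glue_of_lt h, glue_of_lt (by omega)]
      have := hA.2 i j hij h
      omega
    · rw [glue_self]
      rcases hij.lt_or_eq with h | rfl
      · rw [glue_of_lt h]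
        have := hA.1 i h
        omega
      · rw [glue_self]
    · obtain ⟨j, rfl⟩ := Nat.exists_eq_add_of_le h
      rw [Nat.succ_eq_add_one, glue_add]
      rcases lt_trichotomy i a with h' | rfl | h'
      · rw [glue_of_lt h']
        have := hA.1 i h'
        omega
      · rw [glue_self]
        omega
      · obtain ⟨i, rfl⟩ := Nat.exists_eq_add_of_le h'
        rw [Nat.succ_eq_add_one, glue_add]
        have := hB.2 i j (by omega) (by omega)
        omega

theorem jumps_glue_of_lt {i : ℕ} (h : i < a) : jumps (glue a A B) i = jumps A i := by
  induction i with
  | zero => simp only [jumps_zero]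
  | succ i ih =>
    rw [jumps_succ, jumps_succ, ih (by omega), glue_of_lt h, glue_of_lt (by omega)]
    simp

theorem jumps_glue_self (hA : IsEnvelope (a + 1) A) :
    jumps (glue (a + 1) A B) (a + 1) = jumps A a := by
  rw [jumps_succ, glue_self, glue_of_lt (by omega), jumps_glue_of_lt (by omega), hA.apply_last]
  simp

theorem jumps_glue_add (hB : IsEnvelope b B) {i : ℕ} (h : i < b) :
    jumps (glue a A B) (a + 1 + i) = jumps (glue a A B) a + jumps B i := by
  induction i with
  | zero =>
    have e := glue_add (a := a) (A := A) (B := B) 0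
    have := hB.1 0 h
    rw [add_zero] at e ⊢
    rw [jumps_succ, e, glue_self, jumps_zero, if_pos (by omega)]
  | succ i ih =>
    rw [← add_assoc, jumps_succ, ih (by omega), jumps_succ B, add_assoc (a + 1), glue_add, glue_add]
    simp [add_assoc]

theorem containsShape_glue (hA : IsEnvelope a A) (hB : IsEnvelope b B) {p d : ℕ} (hp : 1 ≤ p)
    (hd : 1 ≤ d) :
    ContainsShape (a + b + 1) p (d + 1) (glue a A B) ↔
      ContainsShape a p d A ∨ ContainsShape b p (d + 1) B := by
  have hG := isEnvelope_glue hA hB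
  set G := glue a A B with hGdef
  constructor
  · rintro ⟨i, j, l, hi, hj, hl, h1, h2, h3, h4⟩
    by_cases hia : a < i
    · right
      have hja : a < j := by
        by_contra! h
        have := jumps_mono G h
        obtain ⟨i, rfl⟩ := Nat.exists_eq_add_of_le hia
        have := jumps_pos B i
        rw [Nat.succ_eq_add_one] at *
        have e : jumps G (a + 1 + i) = jumps G a + jumps B i := jumps_glue_add hB (by omega)
        omega
      have hla : a < l := by
        by_contra! h
        have := jumps_mono G (h.trans hja.le)
        omega
      obtain ⟨i, rfl⟩ := Nat.exists_eq_add_of_le hia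
      obtain ⟨j, rfl⟩ := Nat.exists_eq_add_of_le hja
      obtain ⟨l, rfl⟩ := Nat.exists_eq_add_of_le hla
      rw [Nat.succ_eq_add_one] at *
      rw [hGdef, jumps_glue_add hB (by omega), jumps_glue_add hB (by omega)] at h1 h2 h3 h4
      rw [glue_add] at h3 h4
      exact ⟨i, j, l, by omega, by omega, by omega, by omega, by omega, by omega, by omega⟩
    · rw [not_lt] at hia
      have hla : l ≤ a := by
        by_contra! h
        obtain ⟨l, rfl⟩ := Nat.exists_eq_add_of_le h
        rw [Nat.succ_eq_add_one] at *
        have e1 := hG.add_jumps_le hia (by omega)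
        have e2 : G a = a + 1 := glue_self
        have e3 : jumps G (a + 1 + l) = jumps G a + jumps B l := jumps_glue_add hB (by omega)
        have e4 := jumps_le B l
        omega
      have hja : j ≤ a := by
        by_contra! h
        have := jumps_mono G (hla.trans h.le)
        omega
      left
      rcases a with _ | a
      · obtain rfl : l = 0 := by omega
        obtain rfl : j = 0 := by omega
        omega
      · have red : ∀ i ≤ a + 1, ∃ i' < a + 1, i' ≤ i ∧ jumps G i = jumps A i' ∧
            G i = A i' + 1 := by
          intro i hi
          rcases hi.lt_or_eq with h | rfl
          · exact ⟨i, h, le_rfl, jumps_glue_of_lt h, glue_of_lt h⟩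
          · refine ⟨a, by omega, by omega, jumps_glue_self hA, ?_⟩
            rw [hA.apply_last]
            exact glue_self
        obtain ⟨i', hi', -, ei, ei'⟩ := red i hia
        obtain ⟨j', hj', lj, ej, -⟩ := red j hja
        obtain ⟨l', hl', ll, el, -⟩ := red l hla
        exact ⟨i', j', l', by omega, by omega, by omega, by omega, by omega, by omega, by omega⟩
  · rintro (⟨i, j, l, hi, hj, hl, h1, h2, h3, h4⟩ | ⟨i, j, l, hi, hj, hl, h1, h2, h3, h4⟩)
    · refine ⟨i, j, l, by omega, by omega, by omega, ?_⟩
      rw [jumps_glue_of_lt hi, jumps_glue_of_lt hj, jumps_glue_of_lt hl, hGdef, glue_of_lt hi]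
      omega
    · refine ⟨a + 1 + i, a + 1 + j, a + 1 + l, by omega, by omega, by omega, ?_⟩
      rw [jumps_glue_add hB hi, jumps_glue_add hB hj, jumps_glue_add hB hl, hGdef, glue_add]
      omega

end Glue

end Envelopes

section TreeEnvelopes

open Finset BinaryTree

/-- The envelope encoded by a binary tree. -/
def treeEnv : BinaryTree Unit → ℕ → ℕ
  | .nil => fun _ => 0
  | .node _ A B => glue A.numNodes (treeEnv A) (treeEnv B)

theorem isEnvelope_treeEnv (T : BinaryTree Unit) : IsEnvelope T.numNodes (treeEnv T) := by
  induction T with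
  | nil => exact ⟨fun i hi => by simp at hi, fun i j _ hj => by simp at hj⟩
  | node _ A B hA hB => exact isEnvelope_glue hA hB

theorem treeEnv_injective {T T' : BinaryTree Unit} (hn : T.numNodes = T'.numNodes)
    (h : ∀ i < T.numNodes, treeEnv T i = treeEnv T' i) : T = T' := by
  induction T generalizing T' with
  | nil =>
    rcases T' with _ | ⟨_, A', B'⟩
    · rfl
    · simp at hn
  | node _ A B hA hB =>
    rcases T' with _ | ⟨_, A', B'⟩
    · simp at hn
    · simp only [numNodes] at hn h
      simp only [treeEnv] at h
      have ha : A.numNodes = A'.numNodes := by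
        rcases lt_trichotomy A.numNodes A'.numNodes with h' | h' | h'
        · have := h A.numNodes (by omega)
          rw [glue_self, glue_of_lt h'] at this
          have := (isEnvelope_treeEnv A').1 _ h'
          omega
        · exact h'
        · have := h A'.numNodes (by omega)
          rw [glue_self, glue_of_lt h'] at this
          have := (isEnvelope_treeEnv A).1 _ h'
          omega
      have hAA : A = A' := hA ha fun i hi => by
        have := h i (by omega)
        rw [glue_of_lt hi, glue_of_lt (by omega)] at this
        omega
      have hBB : B = B' := hB (by omega) fun i hi => by
        have := h (A.numNodes + 1 + i) (by omega)
        rw [glue_add, ha, glue_add] at this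
        omega
      rw [hAA, hBB]

theorem exists_treeEnv {n : ℕ} {M : ℕ → ℕ} (hM : IsEnvelope n M) :
    ∃ T : BinaryTree Unit, T.numNodes = n ∧ ∀ i < n, treeEnv T i = M i := by
  induction n using Nat.strong_induction_on generalizing M with
  | _ n ih =>
    rcases n with _ | n
    · exact ⟨.nil, rfl, fun i hi => by omega⟩
    · have hex : ∃ a, M a = a + 1 := ⟨n, hM.apply_last⟩
      classical
      obtain ⟨a, ha, hmin⟩ : ∃ a, M a = a + 1 ∧ ∀ i < a, M i ≠ i + 1 :=
        ⟨Nat.find hex, Nat.find_spec hex, fun i hi => Nat.find_min hex hi⟩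
      have han : a ≤ n := by
        by_contra! h
        exact hmin n h hM.apply_last
      obtain ⟨A, hAn, hA⟩ := ih a (by omega) (M := fun i => M i - 1) ⟨fun i hi => by
          have := hM.1 i (by omega)
          have := hmin i hi
          have := hM.2 i a hi.le (by omega)
          dsimp only
          omega, fun i j hij hj => by
          have := hM.2 i j hij (by omega)
          dsimp only
          omega⟩
      obtain ⟨B, hBn, hB⟩ := ih (n - a) (by omega) (M := fun i => M (a + 1 + i) - (a + 1))
        ⟨fun i hi => by
          have := hM.1 (a + 1 + i) (by omega)
          dsimp only
          omega, fun i j hij hj => by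
          have := hM.2 (a + 1 + i) (a + 1 + j) (by omega) (by omega)
          dsimp only
          omega⟩
      refine ⟨.node () A B, by simp only [numNodes]; omega, fun i hi => ?_⟩
      simp only [treeEnv, hAn]
      rcases lt_trichotomy i a with h | rfl | h
      · rw [glue_of_lt h, hA i h]
        have := hM.1 i (by omega)
        omega
      · rw [glue_self, ha]
      · obtain ⟨i, rfl⟩ := Nat.exists_eq_add_of_le h
        rw [Nat.succ_eq_add_one] at *
        rw [glue_add, hB i (by omega)]
        have := hM.1 (a + 1 + i) (by omega)
        omega

open Classical in
/-- The number of envelopes of size `n` that do not contain a given shape. -/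
noncomputable def envCount (p d n : ℕ) : ℕ :=
  #{T ∈ treesOfNumNodesEq n | ¬ ContainsShape n p d (treeEnv T)}

theorem envCount_zero (p d : ℕ) : envCount p d 0 = 1 := by
  have h : ∀ M, ¬ ContainsShape 0 p d M := by
    rintro M ⟨i, j, l, hi, -⟩
    omega
  simp [envCount, h]

theorem envCount_succ {p d : ℕ} (hp : 1 ≤ p) (hd : 1 ≤ d) (n : ℕ) :
    envCount p (d + 1) (n + 1) =
      ∑ ij ∈ antidiagonal n, envCount p d ij.1 * envCount p (d + 1) ij.2 := by
  classical
  rw [envCount, treesOfNumNodesEq_succ, filter_biUnion, card_biUnion]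
  · refine sum_congr rfl ?_
    rintro ⟨a, b⟩ hij
    rw [HasAntidiagonal.mem_antidiagonal] at hij
    rw [envCount, envCount, ← card_product]
    refine (card_nbij' (fun T => (T.left, T.right)) (fun AB => .node () AB.1 AB.2) ?_ ?_ ?_ ?_)
    · intro T hT
      simp only [pairwiseNode, coe_filter, mem_map, mem_product, Set.mem_ofPred_eq,
        mem_treesOfNumNodesEq] at hT
      obtain ⟨⟨⟨A, B⟩, ⟨hA, hB⟩, rfl⟩, hT⟩ := hT
      dsimp only at hA hB hij
      subst hA hB
      rw [← hij] at hT
      have hT' := (containsShape_glue (isEnvelope_treeEnv A) (isEnvelope_treeEnv B) hp hd).not.1 hT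
      rw [not_or] at hT'
      change (A, B) ∈ _
      simpa using hT'
    · rintro ⟨A, B⟩ hAB
      simp only [coe_product, coe_filter, Set.mem_prod, Set.mem_ofPred_eq,
        mem_treesOfNumNodesEq] at hAB
      obtain ⟨⟨hA, hA'⟩, hB, hB'⟩ := hAB
      dsimp only at hij
      subst hA hB
      simp only [pairwiseNode, coe_filter, mem_map, mem_product, Set.mem_ofPred_eq,
        mem_treesOfNumNodesEq]
      refine ⟨⟨(A, B), by simp, rfl⟩, ?_⟩
      simp only [treeEnv, ← hij, containsShape_glue (isEnvelope_treeEnv A) (isEnvelope_treeEnv B)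
        hp hd]
      tauto
    · intro T hT
      simp only [pairwiseNode, coe_filter, mem_map, mem_product, Set.mem_ofPred_eq] at hT
      obtain ⟨⟨⟨A, B⟩, -, rfl⟩, -⟩ := hT
      rfl
    · rintro ⟨A, B⟩ -
      rfl
  · rintro ⟨i, j⟩ - ⟨i', j'⟩ - hne
    rw [Function.onFun, disjoint_left]
    intro T hT hT'
    simp only [pairwiseNode, mem_filter, mem_map, mem_product,
      mem_treesOfNumNodesEq] at hT hT'
    obtain ⟨⟨⟨A, B⟩, ⟨hA, hB⟩, rfl⟩, -⟩ := hT
    obtain ⟨⟨⟨A', B'⟩, ⟨hA', hB'⟩, h⟩, -⟩ := hT'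
    cases h
    exact hne (by rw [← hA, ← hB, ← hA', ← hB'])

theorem containsShape_one_one {n : ℕ} {M : ℕ → ℕ} (hM : IsEnvelope n M) :
    ContainsShape n 1 1 M ↔ ∃ i l, i < n ∧ l < n ∧ i + 2 ≤ M i ∧ M i < M l := by
  constructor
  · rintro ⟨i, j, l, hi, hj, hl, h1, h2, h3, -⟩
    refine ⟨j, l, hj, hl, ?_, (hM.jumps_lt_iff hj hl).1 h2⟩
    rcases le_total i j with h | h
    · have := hM.add_jumps_le h hj
      omega
    · have e := jumps_mono M h
      have := (hM.jumps_lt_iff hj hi).not.1 (by omega)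
      omega
  · rintro ⟨i, l, hi, hl, h1, h2⟩
    classical
    have hex : ∃ l, l < n ∧ M i < M l := ⟨l, hl, h2⟩
    obtain ⟨m, ⟨hm, him⟩, hmin⟩ : ∃ m, (m < n ∧ M i < M m) ∧ ∀ l < m, ¬ (l < n ∧ M i < M l) :=
      ⟨Nat.find hex, Nat.find_spec hex, fun i hi => Nat.find_min hex hi⟩
    have hj := (hM.jumps_lt_iff hi hm).2 him
    have hm0 : m ≤ M i := by
      rcases m with _ | m
      · omega
      · have := hmin m (by omega)
        have := hM.1 m (by omega)
        omega
    exact ⟨i, i, m, hi, hi, hm, by omega, by omega, by omega, by omega⟩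

/-- The left comb, which encodes the constant envelope. -/
def leftComb : ℕ → BinaryTree Unit
  | 0 => .nil
  | n + 1 => .node () (leftComb n) .nil

theorem numNodes_leftComb (n : ℕ) : (leftComb n).numNodes = n := by
  induction n with
  | zero => rfl
  | succ n ih => simp [leftComb, ih]

theorem treeEnv_leftComb {n i : ℕ} (h : i < n) : treeEnv (leftComb n) i = n := by
  induction n with
  | zero => omega
  | succ n ih =>
    simp only [leftComb, treeEnv, numNodes_leftComb]
    rcases (Nat.lt_succ_iff.1 h).lt_or_eq with h' | rfl
    · rw [glue_of_lt h', ih h']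
    · rw [glue_self]

theorem containsShape_one_one_node_nil (B : BinaryTree Unit) :
    ContainsShape (B.numNodes + 1) 1 1 (treeEnv (.node () .nil B)) ↔
      ContainsShape B.numNodes 1 1 (treeEnv B) := by
  have h1 := isEnvelope_treeEnv (.node () .nil B)
  simp only [numNodes, zero_add] at h1
  rw [containsShape_one_one h1, containsShape_one_one (isEnvelope_treeEnv B)]
  simp only [treeEnv, numNodes]
  have e0 : glue 0 (fun _ => 0) (treeEnv B) 0 = 1 := glue_self
  have e1 : ∀ i, glue 0 (fun _ => 0) (treeEnv B) (i + 1) = treeEnv B i + 1 := by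
    intro i
    have := glue_add (a := 0) (A := fun _ => 0) (B := treeEnv B) i
    rwa [zero_add, add_comm 1, add_zero] at this
  constructor
  · rintro ⟨i, l, hi, hl, hil, h⟩
    rcases i with _ | i
    · omega
    rcases l with _ | l
    · rw [e0, e1] at h
      omega
    rw [e1] at hil
    rw [e1, e1] at h
    exact ⟨i, l, by omega, by omega, by omega, by omega⟩
  · rintro ⟨i, l, hi, hl, hil, h⟩
    exact ⟨i + 1, l + 1, by omega, by omega, by rw [e1]; omega, by rw [e1, e1]; omega⟩

theorem envCount_one_one_succ (n : ℕ) :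
    envCount 1 1 (n + 1) = envCount 1 1 n + if n = 0 then 0 else 1 := by
  classical
  have key : ({T ∈ treesOfNumNodesEq (n + 1) | ¬ ContainsShape (n + 1) 1 1 (treeEnv T)}) =
      ({T ∈ treesOfNumNodesEq n | ¬ ContainsShape n 1 1 (treeEnv T)}).image (.node () .nil) ∪
        if n = 0 then ∅ else {leftComb (n + 1)} := by
    ext T
    simp only [mem_filter, mem_treesOfNumNodesEq, mem_union, mem_image]
    constructor
    · rintro ⟨hT, hT'⟩
      rcases T with _ | ⟨⟨⟩, A, B⟩
      · simp at hT
      by_cases hA : A = .nil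
      · subst hA
        left
        obtain rfl : B.numNodes = n := by simpa using hT
        exact ⟨B, ⟨rfl, fun h => hT' ((containsShape_one_one_node_nil B).2 h)⟩, rfl⟩
      · right
        have hA0 : 0 < A.numNodes := by
          rcases A with _ | ⟨_, A, A'⟩
          · exact absurd rfl hA
          · simp
        simp only [numNodes] at hT
        rw [if_neg (by omega), mem_singleton]
        have hE := isEnvelope_treeEnv (.node () A B)
        simp only [numNodes] at hE
        rw [hT] at hE
        rw [containsShape_one_one hE] at hT'
        push Not at hT'
        refine treeEnv_injective (by simp only [numNodes, numNodes_leftComb]; omega)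
          fun i hi => ?_
        simp only [numNodes] at hi
        rw [treeEnv_leftComb (by omega)]
        have h0 : 0 + 2 ≤ treeEnv (.node () A B) 0 := by
          simp only [treeEnv]
          rw [glue_of_lt hA0]
          have := (isEnvelope_treeEnv A).1 0 hA0
          omega
        have h1 := hT' 0 n (by omega) (by omega) h0
        rw [hE.apply_last] at h1
        have h2 := hE.2 0 i (by omega) (by omega)
        have h3 := hE.1 i (by omega)
        exact le_antisymm h3.2 (h1.trans h2)
    · rintro (⟨B, ⟨rfl, hB⟩, rfl⟩ | h)
      · exact ⟨by simp, fun h => hB ((containsShape_one_one_node_nil B).1 h)⟩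
      · split_ifs at h
        · simp at h
        · rw [mem_singleton] at h
          subst h
          refine ⟨numNodes_leftComb _, ?_⟩
          have hE := isEnvelope_treeEnv (leftComb (n + 1))
          rw [numNodes_leftComb] at hE
          rw [containsShape_one_one hE]
          rintro ⟨i, l, hi, hl, -, h⟩
          rw [treeEnv_leftComb hi, treeEnv_leftComb hl] at h
          omega
  rw [envCount, key, card_union_of_disjoint, card_image_of_injective, envCount]
  · split_ifs <;> simp
  · intro B B' h
    cases h
    rfl
  · split_ifs with h
    · simp
    · rw [disjoint_singleton_right, mem_image]
      rintro ⟨B, -, h'⟩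
      obtain ⟨n, rfl⟩ := Nat.exists_eq_succ_of_ne_zero h
      simp [leftComb] at h'

theorem isChebQuotient_envCount_one_one : IsChebQuotient (envCount 1 1) 0 := by
  refine isChebQuotient_zero (envCount_zero 1 1) fun n => ?_
  induction n with
  | zero => rw [envCount_one_one_succ, envCount_zero]; rfl
  | succ n ih => rw [envCount_one_one_succ, ih]; simp

theorem IsChebQuotient.envCount_succ {p d m : ℕ} (hp : 1 ≤ p) (hd : 1 ≤ d)
    (h : IsChebQuotient (envCount p d) m) : IsChebQuotient (envCount p (d + 1)) (m + 1) :=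
  h.succ (envCount_zero _ _) (_root_.envCount_succ hp hd)

end TreeEnvelopes

section Records

open Finset

variable {n : ℕ} {π : Equiv.Perm (Fin n)}

/-- No three entries of `π` are in decreasing order. -/
def Avoids321 (π : Equiv.Perm (Fin n)) : Prop :=
  ∀ i j l, i < j → j < l → π j < π i → ¬ π l < π j

/-- The entry at position `i` is a left-to-right maximum. -/
def IsRecord (π : Equiv.Perm (Fin n)) (i : Fin n) : Prop :=
  ∀ j < i, π j < π i

/-- One more than the running maximum of the entries of `π`. -/
def permEnv (π : Equiv.Perm (Fin n)) (i : ℕ) : ℕ :=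
  ({j : Fin n | j.val ≤ i} : Finset (Fin n)).sup fun j => (π j).val + 1

theorem IsRecord.lt_iff {i j : Fin n} (hi : IsRecord π i) (hj : IsRecord π j) :
    π i < π j ↔ i < j := by
  refine ⟨fun h => ?_, fun h => hj i h⟩
  rcases lt_trichotomy i j with h' | rfl | h'
  · exact h'
  · exact absurd h (lt_irrefl _)
  · exact absurd h (hi j h').asymm

theorem exists_of_not_isRecord {i : Fin n} (hi : ¬ IsRecord π i) : ∃ j < i, π i < π j := by
  simp only [IsRecord, not_forall, not_lt] at hi
  obtain ⟨j, hj, h⟩ := hi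
  exact ⟨j, hj, lt_of_le_of_ne h fun e => hj.ne' (π.injective e)⟩

theorem Avoids321.lt_of_not_isRecord (hπ : Avoids321 π) {i j : Fin n} (hi : ¬ IsRecord π i)
    (hij : i < j) : π i < π j := by
  obtain ⟨h, hhi, hh⟩ := exists_of_not_isRecord hi
  exact lt_of_le_of_ne (not_lt.1 (hπ h i j hhi hij hh)) fun e => hij.ne (π.injective e)

theorem Avoids321.isRecord_of_lt (hπ : Avoids321 π) {i j : Fin n} (hij : i < j) (h : π j < π i) :
    IsRecord π i := by
  by_contra hi
  exact (hπ.lt_of_not_isRecord hi hij).asymm h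

theorem lt_permEnv {j : Fin n} {i : ℕ} (h : j.val ≤ i) : (π j).val + 1 ≤ permEnv π i :=
  le_sup (f := fun j => (π j).val + 1) (by simpa using h)

theorem permEnv_le {i b : ℕ} (h : ∀ j : Fin n, j.val ≤ i → (π j).val + 1 ≤ b) :
    permEnv π i ≤ b :=
  Finset.sup_le fun j hj => h j (by simpa using hj)

theorem permEnv_mono (π : Equiv.Perm (Fin n)) : Monotone (permEnv π) := fun _ _ h =>
  permEnv_le fun _ hj => lt_permEnv (hj.trans h)

theorem IsRecord.permEnv_eq {i : Fin n} (hi : IsRecord π i) : permEnv π i = (π i).val + 1 := by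
  refine le_antisymm (permEnv_le fun j hj => ?_) (lt_permEnv le_rfl)
  rcases (show j ≤ i from hj).lt_or_eq with h | rfl
  · have := Fin.lt_def.1 (hi j h)
    omega
  · rfl

theorem isEnvelope_permEnv (π : Equiv.Perm (Fin n)) : IsEnvelope n (permEnv π) := by
  refine ⟨fun i hi => ⟨?_, permEnv_le fun j _ => (π j).isLt⟩, fun i j h _ => permEnv_mono π h⟩
  have h := card_le_card_of_injOn (s := range (i + 1)) (t := range (permEnv π i))
    (fun j => if h : j < n then (π ⟨j, h⟩).val else 0) ?_ ?_
  · simpa using h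
  · intro j hj
    simp only [coe_range, Set.mem_Iio] at hj ⊢
    rw [dif_pos (by omega)]
    exact lt_permEnv (j := ⟨j, by omega⟩) (by simp; omega)
  · intro j hj l hl h
    simp only [coe_range, Set.mem_Iio] at hj hl
    simp only at h
    rw [dif_pos (by omega), dif_pos (by omega)] at h
    have := π.injective (Fin.ext h)
    simpa using this

theorem isRecord_iff_permEnv (i : Fin n) :
    IsRecord π i ↔ i.val = 0 ∨ permEnv π (i.val - 1) < permEnv π i.val := by
  constructor
  · intro hi
    rcases Nat.eq_zero_or_pos i.val with h0 | h0
    · exact Or.inl h0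
    · right
      rw [hi.permEnv_eq, Nat.lt_succ_iff]
      refine permEnv_le fun j hj => ?_
      exact Fin.lt_def.1 (hi j (Fin.lt_def.2 (by omega)))
  · intro h j hj
    rw [Fin.lt_def] at hj
    have h := h.resolve_left (by omega)
    have h1 := lt_permEnv (π := π) (show j.val ≤ i.val - 1 by omega)
    by_contra! h2
    rw [Fin.le_def] at h2
    refine h.not_ge (permEnv_le fun l hl => ?_)
    rcases hl.lt_or_eq with h' | h'
    · exact lt_permEnv (by omega)
    · rw [Fin.ext h']
      omega

open Classical in
theorem jumps_permEnv (i : Fin n) : jumps (permEnv π) i = #{j | j ≤ i ∧ IsRecord π j} := by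
  rw [jumps, ← card_map Fin.valEmbedding]
  congr 1
  ext j
  simp only [mem_filter, mem_range, mem_map, mem_univ, true_and, Fin.valEmbedding_apply,
    isRecord_iff_permEnv]
  constructor
  · rintro ⟨h, h'⟩
    exact ⟨⟨j, by omega⟩, ⟨Fin.le_def.2 (by simp; omega), h'⟩, rfl⟩
  · rintro ⟨j, ⟨h, h'⟩, rfl⟩
    exact ⟨by rw [Fin.le_def] at h; omega, h'⟩

open Classical in
theorem card_nonrecords_add_jumps (i : Fin n) :
    #{j | j ≤ i ∧ ¬ IsRecord π j} + jumps (permEnv π) i = i.val + 1 := by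
  rw [jumps_permEnv, ← Fin.card_Iic, ← card_filter_add_card_filter_not (s := Iic i) (IsRecord π),
    add_comm]
  congr 2 <;> ext <;> simp

open Classical in
theorem IsRecord.card_nonrecords_add_jumps {i : Fin n} (hi : IsRecord π i) :
    #{j | π j ≤ π i ∧ ¬ IsRecord π j} + jumps (permEnv π) i = permEnv π i := by
  have h : #{j | π j ≤ π i} = permEnv π i := by
    rw [hi.permEnv_eq, ← Fin.card_Iic]
    exact card_equiv π (by simp)
  rw [← h, jumps_permEnv, ← card_filter_add_card_filter_not (s := ({j | π j ≤ π i} : Finset _))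
    (IsRecord π), add_comm, filter_filter, filter_filter]
  congr 2
  ext j
  simp only [mem_filter, mem_univ, true_and]
  refine and_congr_left fun hj => ?_
  rw [← not_lt, ← not_lt, hi.lt_iff hj]

theorem exists_isRecord_permEnv_eq (i : Fin n) :
    ∃ j ≤ i, IsRecord π j ∧ permEnv π j = permEnv π i ∧
      jumps (permEnv π) j = jumps (permEnv π) i := by
  have hE := isEnvelope_permEnv π
  suffices h : ∀ (m : ℕ) (hm : m < n), ∃ j : Fin n, j.val ≤ m ∧ IsRecord π j ∧
      permEnv π j = permEnv π m ∧ jumps (permEnv π) j = jumps (permEnv π) m from h i i.isLt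
  intro m
  induction m with
  | zero => exact fun hm => ⟨⟨0, hm⟩, le_rfl, (isRecord_iff_permEnv _).2 (Or.inl rfl), rfl, rfl⟩
  | succ m ih =>
    intro hm
    by_cases h : permEnv π m < permEnv π (m + 1)
    · exact ⟨⟨m + 1, hm⟩, le_rfl, (isRecord_iff_permEnv _).2 (Or.inr (by simpa using h)), rfl, rfl⟩
    · obtain ⟨j, hj, hr, h1, h2⟩ := ih (by omega)
      have := permEnv_mono π (Nat.le_succ m)
      refine ⟨j, by omega, hr, by rw [h1]; simp only [Nat.succ_eq_add_one] at this; omega, ?_⟩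
      rw [jumps_succ, if_neg h, h2, add_zero]

/-- A permutation avoiding `321` is determined by its running maxima. -/
theorem Avoids321.ext_permEnv {π' : Equiv.Perm (Fin n)} (hπ : Avoids321 π) (hπ' : Avoids321 π')
    (h : ∀ i < n, permEnv π i = permEnv π' i) : π = π' := by
  have least : ∀ {σ : Equiv.Perm (Fin n)}, Avoids321 σ → ∀ {j}, ¬ IsRecord σ j →
      ∀ v, (∀ i < j, σ i ≠ v) → σ j ≤ v := by
    intro σ hσ j hj v hv
    obtain ⟨l, rfl⟩ := σ.surjective v
    rcases lt_trichotomy l j with h | rfl | h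
    · exact absurd rfl (hv l h)
    · exact le_rfl
    · exact (hσ.lt_of_not_isRecord hj h).le
  have hrec : ∀ j, IsRecord π j ↔ IsRecord π' j := fun j => by
    rw [isRecord_iff_permEnv, isRecord_iff_permEnv, h _ j.isLt, h _ (by omega)]
  suffices H : ∀ (m : ℕ) (hm : m < n), π ⟨m, hm⟩ = π' ⟨m, hm⟩ from Equiv.ext fun i => H i i.isLt
  intro m
  induction m using Nat.strong_induction_on with
  | _ m ih =>
    intro hm
    have ih' : ∀ i : Fin n, i < ⟨m, hm⟩ → π i = π' i := fun i hi => ih i hi i.isLt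
    by_cases hr : IsRecord π ⟨m, hm⟩
    · have e := hr.permEnv_eq
      have e' := ((hrec _).1 hr).permEnv_eq
      dsimp only at e e'
      rw [h _ hm] at e
      exact Fin.ext (by omega)
    · refine le_antisymm (least hπ hr _ fun i hi => ?_)
        (least hπ' ((hrec _).not.1 hr) _ fun i hi => ?_)
      · rw [ih' i hi]
        exact π'.injective.ne hi.ne
      · rw [← ih' i hi]
        exact π.injective.ne hi.ne

open Classical in
/-- The one-line notation of the `321`-avoiding permutation with envelope `M`: at each jump of `M`
the new maximum, elsewhere the least value not used yet. -/
noncomputable def fillEnv (M : ℕ → ℕ) (j : ℕ) : ℕ :=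
  if j = 0 ∨ M (j - 1) < M j then M j - 1 else sInf {v | ∀ i, (_ : i < j) → fillEnv M i ≠ v}

theorem fillEnv_of_jump {M : ℕ → ℕ} {j : ℕ} (h : j = 0 ∨ M (j - 1) < M j) :
    fillEnv M j = M j - 1 := by
  rw [fillEnv, if_pos h]

theorem exists_le_unused (g : ℕ → ℕ) (j : ℕ) : ∃ v ≤ j, ∀ i < j, g i ≠ v := by
  obtain ⟨v, hv, hv'⟩ := exists_mem_notMem_of_card_lt_card
    (s := (range j).image g) (t := range (j + 1)) (by
      rw [card_range]
      exact card_image_le.trans_lt (by simp))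
  exact ⟨v, by simpa [Nat.lt_succ_iff] using hv, by simpa using hv'⟩

theorem fillEnv_of_not_jump {M : ℕ → ℕ} {j : ℕ} (h : ¬ (j = 0 ∨ M (j - 1) < M j)) :
    fillEnv M j ≤ j ∧ (∀ i < j, fillEnv M i ≠ fillEnv M j) ∧
      ∀ v, (∀ i < j, fillEnv M i ≠ v) → fillEnv M j ≤ v := by
  obtain ⟨v, hvj, hv⟩ := exists_le_unused (fillEnv M) j
  have e : fillEnv M j = sInf {v | ∀ i < j, fillEnv M i ≠ v} := by
    rw [fillEnv, if_neg h]
  have hle : ∀ v, (∀ i < j, fillEnv M i ≠ v) → fillEnv M j ≤ v := fun v hv => by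
    rw [e]
    exact Nat.sInf_le hv
  refine ⟨(hle v hv).trans hvj, ?_, hle⟩
  have := Nat.sInf_mem (s := {v | ∀ i < j, fillEnv M i ≠ v}) ⟨v, hv⟩
  rwa [← e] at this

theorem IsEnvelope.fillEnv_lt {M : ℕ → ℕ} (hM : IsEnvelope n M) {j : ℕ} (hj : j < n) :
    fillEnv M j < M j := by
  have := hM.1 j hj
  by_cases h : j = 0 ∨ M (j - 1) < M j
  · rw [fillEnv_of_jump h]
    omega
  · have := (fillEnv_of_not_jump h).1
    omega

theorem IsEnvelope.fillEnv_ne {M : ℕ → ℕ} (hM : IsEnvelope n M) {i j : ℕ} (hij : i < j)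
    (hj : j < n) : fillEnv M i ≠ fillEnv M j := by
  by_cases h : j = 0 ∨ M (j - 1) < M j
  · rw [fillEnv_of_jump h]
    have := hM.fillEnv_lt (show i < n by omega)
    have := hM.2 i (j - 1) (by omega) (by omega)
    omega
  · exact (fillEnv_of_not_jump h).2.1 i hij

theorem exists_perm_of_isEnvelope {M : ℕ → ℕ} (hM : IsEnvelope n M) :
    ∃ π : Equiv.Perm (Fin n), Avoids321 π ∧ ∀ i < n, permEnv π i = M i := by
  let g : Fin n → Fin n := fun i =>
    ⟨fillEnv M i, (hM.fillEnv_lt i.isLt).trans_le (hM.1 i i.isLt).2⟩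
  have hg : Function.Injective g := by
    intro i j h
    have h : fillEnv M i = fillEnv M j := congrArg Fin.val h
    rcases lt_trichotomy i j with h' | h' | h'
    · exact absurd h (hM.fillEnv_ne h' j.isLt)
    · exact h'
    · exact absurd h.symm (hM.fillEnv_ne h' i.isLt)
  let π : Equiv.Perm (Fin n) := Equiv.ofBijective g (Finite.injective_iff_bijective.1 hg)
  have hπ : ∀ i, (π i).val = fillEnv M i := fun i => rfl
  refine ⟨π, ?_, ?_⟩
  · intro i j l hij hjl h h'
    rw [Fin.lt_def] at *
    rw [hπ, hπ] at h h'
    by_cases hj : j.val = 0 ∨ M (j.val - 1) < M j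
    · rw [fillEnv_of_jump hj] at h
      have := hM.fillEnv_lt i.isLt
      have := hM.2 i (j.val - 1) (by omega) (by omega)
      omega
    · have := (fillEnv_of_not_jump hj).2.2 (fillEnv M l) fun i hi =>
        hM.fillEnv_ne (by omega) l.isLt
      omega
  · intro i
    induction i with
    | zero =>
      intro hi
      refine le_antisymm (permEnv_le fun j hj => ?_) ?_
      · rw [hπ]
        have := hM.fillEnv_lt j.isLt
        rwa [show j.val = 0 by omega] at this ⊢
      · have := lt_permEnv (π := π) (j := ⟨0, hi⟩) le_rfl
        rw [hπ, fillEnv_of_jump (Or.inl rfl)] at this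
        dsimp only at this
        omega
    | succ i ih =>
      intro hi
      refine le_antisymm (permEnv_le fun j hj => ?_) ?_
      · rw [hπ]
        have := hM.fillEnv_lt j.isLt
        have := hM.2 j (i + 1) hj hi
        omega
      · by_cases h : M i < M (i + 1)
        · have := lt_permEnv (π := π) (j := ⟨i + 1, hi⟩) le_rfl
          rw [hπ, fillEnv_of_jump (Or.inr (by simpa using h))] at this
          dsimp only at this
          omega
        · have := permEnv_mono π (Nat.le_succ i)
          rw [ih (by omega), Nat.succ_eq_add_one] at this
          omega

end Records

section Configurations

open Finset

variable {n p q : ℕ} {π : Equiv.Perm (Fin n)}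

/-- In `π` there are `p` entries `U`, `q` entries `V` and two more entries at positions `x` and `y`
that together form, up to the order of `x` and `y`, an occurrence of one of the two long
patterns. -/
def HasConfig (π : Equiv.Perm (Fin n)) (p q : ℕ) : Prop :=
  ∃ (U V : Finset (Fin n)) (x y : Fin n), #U = p ∧ #V = q ∧ (∀ u ∈ U, u < x ∧ u < y ∧ π u < π y) ∧
    (∀ v ∈ V, x < v ∧ y < v ∧ π x < π v) ∧ ∀ u ∈ U, ∀ v ∈ V, π v < π u

theorem HasConfig.containsShape (hπ : Avoids321 π) (hp : 1 ≤ p) (hq : 1 ≤ q)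
    (h : HasConfig π p q) : ContainsShape n p (q + 1) (permEnv π) := by
  classical
  obtain ⟨U, V, x, y, hU, hV, hUxy, hVxy, hUV⟩ := h
  have hUne : U.Nonempty := card_pos.1 (by omega)
  have hVne : V.Nonempty := card_pos.1 (by omega)
  obtain ⟨v₀, hv₀⟩ := hVne
  set i := U.min' hUne
  set j := U.max' hUne
  have hiU : i ∈ U := U.min'_mem hUne
  have hjU : j ∈ U := U.max'_mem hUne
  have hUrec : ∀ u ∈ U, IsRecord π u := fun u hu =>
    hπ.isRecord_of_lt ((hUxy u hu).1.trans (hVxy v₀ hv₀).1) (hUV u hu v₀ hv₀)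
  have hyrec : IsRecord π y :=
    hπ.isRecord_of_lt (hVxy v₀ hv₀).2.1 ((hUV i hiU v₀ hv₀).trans (hUxy i hiU).2.2)
  have hxi : π x < π i := (hVxy v₀ hv₀).2.2.trans (hUV i hiU v₀ hv₀)
  have hxrec : ¬ IsRecord π x := fun h => (h i (hUxy i hiU).1).asymm hxi
  have hVrec : ∀ v ∈ V, ¬ IsRecord π v := fun v hv h =>
    (h i ((hUxy i hiU).1.trans (hVxy v hv).1)).asymm (hUV i hiU v hv)
  refine ⟨i, j, y, i.isLt, j.isLt, y.isLt, ?_, ?_, ?_, ?_⟩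
  · have : #(U.erase i ∪ ({h | h ≤ i ∧ IsRecord π h} : Finset _)) ≤
        #({h | h ≤ j ∧ IsRecord π h} : Finset _) := by
      refine card_le_card fun h hh => ?_
      simp only [mem_union, mem_erase, mem_filter, mem_univ, true_and] at hh ⊢
      rcases hh with ⟨-, hh⟩ | ⟨hh, hr⟩
      · exact ⟨U.le_max' h hh, hUrec h hh⟩
      · exact ⟨hh.trans (U.min'_le j hjU), hr⟩
    rw [card_union_of_disjoint, card_erase_of_mem hiU, ← jumps_permEnv, ← jumps_permEnv] at this
    · omega
    · rw [disjoint_left]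
      intro h hh hh'
      simp only [mem_erase, mem_filter, mem_univ, true_and] at hh hh'
      exact hh.1 (le_antisymm hh'.1 (U.min'_le h hh.2))
  · have : #(insert y ({h | h ≤ j ∧ IsRecord π h} : Finset _)) ≤
        #({h | h ≤ y ∧ IsRecord π h} : Finset _) := by
      refine card_le_card fun h hh => ?_
      simp only [mem_insert, mem_filter, mem_univ, true_and] at hh ⊢
      rcases hh with rfl | ⟨hh, hr⟩
      · exact ⟨le_rfl, hyrec⟩
      · exact ⟨hh.trans (hUxy j hjU).2.1.le, hr⟩
    rwa [card_insert_of_notMem (by simp [(hUxy j hjU).2.1]), ← jumps_permEnv,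
      ← jumps_permEnv] at this
  · have : #(({h | h ≤ j ∧ ¬ IsRecord π h} : Finset _) ∪ insert x V) ≤
        #({h | π h ≤ π i ∧ ¬ IsRecord π h} : Finset _) := by
      refine card_le_card fun h hh => ?_
      simp only [mem_union, mem_insert, mem_filter, mem_univ, true_and] at hh ⊢
      rcases hh with ⟨hh, hr⟩ | rfl | hh
      · exact ⟨((hπ.lt_of_not_isRecord hr (hh.trans_lt (hUxy j hjU).1)).trans hxi).le, hr⟩
      · exact ⟨hxi.le, hxrec⟩
      · exact ⟨(hUV i hiU h hh).le, hVrec h hh⟩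
    rw [card_union_of_disjoint, card_insert_of_notMem fun h => (hVxy x h).1.false] at this
    · have h1 := card_nonrecords_add_jumps (π := π) j
      have h2 := (hUrec i hiU).card_nonrecords_add_jumps
      omega
    · rw [disjoint_left]
      intro h hh hh'
      simp only [mem_insert, mem_filter, mem_univ, true_and] at hh hh'
      rcases hh' with rfl | hh'
      · exact hh.1.not_gt (hUxy j hjU).1
      · exact hh.1.not_gt ((hUxy j hjU).1.trans (hVxy h hh').1)
  · have : #(({h | h ≤ y ∧ ¬ IsRecord π h} : Finset _) ∪ V) ≤
        #({h | π h ≤ π i ∧ ¬ IsRecord π h} : Finset _) := by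
      refine card_le_card fun h hh => ?_
      simp only [mem_union, mem_filter, mem_univ, true_and] at hh ⊢
      rcases hh with ⟨hh, hr⟩ | hh
      · exact ⟨((hπ.lt_of_not_isRecord hr (hh.trans_lt (hVxy v₀ hv₀).2.1)).trans
          (hUV i hiU v₀ hv₀)).le, hr⟩
      · exact ⟨(hUV i hiU h hh).le, hVrec h hh⟩
    rw [card_union_of_disjoint] at this
    · have h1 := card_nonrecords_add_jumps (π := π) y
      have h2 := (hUrec i hiU).card_nonrecords_add_jumps
      omega
    · rw [disjoint_left]
      intro h hh hh'
      simp only [mem_filter, mem_univ, true_and] at hh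
      exact hh.1.not_gt (hVxy h hh').2.1

theorem ContainsShape.hasConfig (hπ : Avoids321 π)
    (h : ContainsShape n p (q + 1) (permEnv π)) : HasConfig π p q := by
  classical
  obtain ⟨i', j', l', hi', hj', hl', h1, h2, h3, h4⟩ := h
  obtain ⟨i, -, hi, e1, e2⟩ := exists_isRecord_permEnv_eq (π := π) ⟨i', hi'⟩
  obtain ⟨j, rfl⟩ : ∃ j : Fin n, j.val = j' := ⟨⟨j', hj'⟩, rfl⟩
  obtain ⟨l, rfl⟩ : ∃ l : Fin n, l.val = l' := ⟨⟨l', hl'⟩, rfl⟩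
  dsimp only at e1 e2
  rw [← e2] at h1 h3 h4
  rw [← e1] at h3 h4
  have hN := hi.card_nonrecords_add_jumps
  have hNj := card_nonrecords_add_jumps (π := π) j
  have hNl := card_nonrecords_add_jumps (π := π) l
  obtain ⟨U, hUs, hU⟩ : ∃ U ⊆ ({h | i ≤ h ∧ h ≤ j ∧ IsRecord π h} : Finset (Fin n)), #U = p := by
    refine exists_subset_card_eq ?_
    have : #({h | h ≤ j ∧ IsRecord π h} : Finset _) ≤
        #(({h | i ≤ h ∧ h ≤ j ∧ IsRecord π h} : Finset _) ∪
          ({h | h ≤ i ∧ IsRecord π h} : Finset _).erase i) := by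
      refine card_le_card fun h hh => ?_
      simp only [mem_union, mem_erase, mem_filter, mem_univ, true_and] at hh ⊢
      rcases le_or_gt i h with h' | h'
      · exact Or.inl ⟨h', hh⟩
      · exact Or.inr ⟨h'.ne, h'.le, hh.2⟩
    have := this.trans (card_union_le _ _)
    rw [card_erase_of_mem (by simpa using hi), ← jumps_permEnv, ← jumps_permEnv] at this
    have := jumps_pos (permEnv π) i
    omega
  obtain ⟨y, hyl, hjy, hy⟩ : ∃ y, y ≤ l ∧ j < y ∧ IsRecord π y := by
    rw [jumps_permEnv, jumps_permEnv] at h2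
    obtain ⟨y, hy, hy'⟩ := exists_mem_notMem_of_card_lt_card (Nat.lt_of_succ_le h2)
    simp only [mem_filter, mem_univ, true_and, not_and] at hy hy'
    exact ⟨y, hy.1, not_le.1 fun h => hy' h hy.2, hy.2⟩
  have key : ∀ m : Fin n, #({h | π h ≤ π i ∧ ¬ IsRecord π h} : Finset _) ≤
      #({h | m < h ∧ π h ≤ π i ∧ ¬ IsRecord π h} : Finset _) +
        #({h | h ≤ m ∧ ¬ IsRecord π h} : Finset _) := by
    intro m
    refine (card_le_card fun h hh => ?_).trans (card_union_le _ _)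
    simp only [mem_union, mem_filter, mem_univ, true_and] at hh ⊢
    rcases lt_or_ge m h with h' | h'
    · exact Or.inl ⟨h', hh⟩
    · exact Or.inr ⟨h', hh.2⟩
  have keyj := key j
  have keyl := key l
  set W : Finset (Fin n) := {h | j < h ∧ π h ≤ π i ∧ ¬ IsRecord π h} with hW
  set W' : Finset (Fin n) := {h | l < h ∧ π h ≤ π i ∧ ¬ IsRecord π h} with hW'
  have hWne : W.Nonempty := card_pos.1 (by omega)
  have hx := W.min'_mem hWne
  set x := W.min' hWne
  simp only [hW, mem_filter, mem_univ, true_and] at hx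
  obtain ⟨V, hVs, hV⟩ : ∃ V ⊆ W'.erase x, #V = q := by
    refine exists_subset_card_eq ?_
    by_cases hxW : x ∈ W'
    · have : W ⊆ W' := fun h hh => by
        have hxh := W.min'_le h hh
        simp only [hW, hW', mem_filter, mem_univ, true_and] at hh hxW ⊢
        exact ⟨hxW.1.trans_le hxh, hh.2⟩
      have := card_le_card this
      rw [card_erase_of_mem hxW]
      omega
    · rw [erase_eq_of_notMem hxW]
      omega
  refine ⟨U, V, x, y, hU, hV, fun u hu => ?_, fun v hv => ?_, fun u hu v hv => ?_⟩
  · have hu := hUs hu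
    simp only [mem_filter, mem_univ, true_and] at hu
    exact ⟨hu.2.1.trans_lt hx.1, hu.2.1.trans_lt hjy, hy u (hu.2.1.trans_lt hjy)⟩
  · have hv := hVs hv
    simp only [hW', mem_erase, mem_filter, mem_univ, true_and] at hv
    have hxv : x < v := by
      refine lt_of_le_of_ne (W.min'_le v ?_) hv.1.symm
      simp only [hW, mem_filter, mem_univ, true_and]
      exact ⟨(hjy.trans_le hyl).trans hv.2.1, hv.2.2⟩
    exact ⟨hxv, hyl.trans_lt hv.2.1, hπ.lt_of_not_isRecord hx.2.2 hxv⟩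
  · have hu := hUs hu
    have hv := hVs hv
    simp only [hW', mem_erase, mem_filter, mem_univ, true_and] at hu hv
    refine lt_of_le_of_ne (hv.2.2.1.trans ?_) fun e => ?_
    · exact not_lt.1 fun h => hu.1.not_gt ((hu.2.2.lt_iff hi).1 h)
    · exact hv.2.2.2 (π.injective e ▸ hu.2.2)

theorem hasConfig_iff_containsShape (hπ : Avoids321 π) (hp : 1 ≤ p) (hq : 1 ≤ q) :
    HasConfig π p q ↔ ContainsShape n p (q + 1) (permEnv π) :=
  ⟨fun h => h.containsShape hπ hp hq, fun h => h.hasConfig hπ⟩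

/-- The running maxima put the `321`-avoiding permutations without a configuration in bijection with
the envelopes counted by `envCount`. -/
theorem card_avoiders_eq_envCount (hp : 1 ≤ p) (hq : 1 ≤ q) (n : ℕ) :
    Nat.card {π : Equiv.Perm (Fin n) // Avoids321 π ∧ ¬ HasConfig π p q} =
      envCount p (q + 1) n := by
  classical
  rw [Nat.card_eq_fintype_card, Fintype.card_subtype, envCount]
  choose t ht ht' using fun π : Equiv.Perm (Fin n) => exists_treeEnv (isEnvelope_permEnv π)
  refine card_bij (fun π _ => t π) (fun π hπ => ?_) (fun π hπ π' hπ' h => ?_) fun T hT => ?_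
  · simp only [mem_filter, mem_univ, true_and, BinaryTree.mem_treesOfNumNodesEq] at hπ ⊢
    rw [hasConfig_iff_containsShape hπ.1 hp hq, ← containsShape_congr (ht' π)] at hπ
    exact ⟨ht π, hπ.2⟩
  · simp only [mem_filter, mem_univ, true_and] at hπ hπ'
    refine hπ.1.ext_permEnv hπ'.1 fun i hi => ?_
    rw [← ht' π i hi, ← ht' π' i hi, h]
  · simp only [mem_filter, BinaryTree.mem_treesOfNumNodesEq] at hT
    obtain ⟨rfl, hT⟩ := hT
    obtain ⟨π, hπ, h⟩ := exists_perm_of_isEnvelope (isEnvelope_treeEnv T)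
    refine ⟨π, ?_, treeEnv_injective (ht π) fun i hi => ?_⟩
    · simp only [mem_filter, mem_univ, true_and]
      rw [hasConfig_iff_containsShape hπ hp hq, containsShape_congr h]
      exact ⟨hπ, hT⟩
    · rw [ht π] at hi
      rw [ht' π i hi, h i hi]

theorem Avoids321.permCongr_rev (h : Avoids321 π) :
    Avoids321 (Fin.revPerm.permCongr π) := by
  intro i j l hij hjl h1 h2
  simp only [Equiv.permCongr_apply, Fin.revPerm_symm, Fin.revPerm_apply, Fin.rev_lt_rev] at h1 h2
  exact h _ _ _ (Fin.rev_lt_rev.2 hjl) (Fin.rev_lt_rev.2 hij) h2 h1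

theorem HasConfig.permCongr_rev (h : HasConfig π p q) :
    HasConfig (Fin.revPerm.permCongr π) q p := by
  obtain ⟨U, V, x, y, hU, hV, hUxy, hVxy, hUV⟩ := h
  refine ⟨V.map Fin.revPerm.toEmbedding, U.map Fin.revPerm.toEmbedding, Fin.rev y, Fin.rev x,
    by rw [card_map, hV], by rw [card_map, hU], ?_, ?_, ?_⟩
  · simp only [mem_map_equiv, Fin.revPerm_symm, Fin.revPerm_apply, Equiv.permCongr_apply]
    intro v hv
    obtain ⟨h1, h2, h3⟩ := hVxy _ hv
    exact ⟨Fin.lt_rev_iff.1 h2, Fin.lt_rev_iff.1 h1, by simpa using h3⟩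
  · simp only [mem_map_equiv, Fin.revPerm_symm, Fin.revPerm_apply, Equiv.permCongr_apply]
    intro u hu
    obtain ⟨h1, h2, h3⟩ := hUxy _ hu
    exact ⟨Fin.rev_lt_iff.1 h2, Fin.rev_lt_iff.1 h1, by simpa using h3⟩
  · simp only [mem_map_equiv, Fin.revPerm_symm, Fin.revPerm_apply, Equiv.permCongr_apply,
      Fin.rev_lt_rev]
    exact fun v hv u hu => hUV _ hu _ hv

theorem permCongr_rev_permCongr_rev (π : Equiv.Perm (Fin n)) :
    Fin.revPerm.permCongr (Fin.revPerm.permCongr π) = π := by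
  ext i
  simp

theorem envCount_symm (hp : 1 ≤ p) (hq : 1 ≤ q) (n : ℕ) :
    envCount p (q + 1) n = envCount q (p + 1) n := by
  rw [← card_avoiders_eq_envCount hp hq, ← card_avoiders_eq_envCount hq hp]
  refine Nat.card_congr (Fin.revPerm.permCongr.subtypeEquiv fun π => and_congr ?_ (not_congr ?_))
  · exact ⟨Avoids321.permCongr_rev, fun h => permCongr_rev_permCongr_rev π ▸ h.permCongr_rev⟩
  · exact ⟨HasConfig.permCongr_rev, fun h => permCongr_rev_permCongr_rev π ▸ h.permCongr_rev⟩

theorem isChebQuotient_envCount (hp : 1 ≤ p) (hq : 1 ≤ q) :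
    IsChebQuotient (envCount p (q + 1)) (p + q - 1) := by
  have one : ∀ m, IsChebQuotient (envCount 1 (m + 1)) m := by
    intro m
    induction m with
    | zero => exact isChebQuotient_envCount_one_one
    | succ m ih => exact ih.envCount_succ le_rfl (by omega)
  induction q, hq using Nat.le_induction with
  | base =>
    rw [funext (envCount_symm hp le_rfl)]
    exact one p
  | succ q hq ih =>
    have := ih.envCount_succ hp (by omega)
    rwa [show p + q - 1 + 1 = p + (q + 1) - 1 by omega] at this

end Configurations

section Patterns

open Finset

variable {n p q : ℕ} {π : Equiv.Perm (Fin n)}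

theorem containsPattern_iff {w : List ℕ} {c : ℕ → ℕ} {m : ℕ} (hlen : w.length = m) (hm : 0 < m)
    (hw : ∀ a (h : a < w.length), w[a] = c a) (hc : ∀ a < m, ∀ b < m, c a = c b → a = b) :
    ContainsPattern π w ↔ ∃ F : ℕ → Fin n, (∀ a b, a < b → b < m → F a < F b) ∧
      ∀ a b, a < m → b < m → c a < c b → π (F a) < π (F b) := by
  subst hlen
  constructor
  · rintro ⟨f, hf, h⟩
    have hF : ∀ a, min a (w.length - 1) < w.length := fun a => by omega
    have hF' : ∀ a (ha : a < w.length),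
        (⟨min a (w.length - 1), hF a⟩ : Fin w.length) = ⟨a, ha⟩ := fun a ha => by
      simp only [Fin.mk.injEq]
      omega
    refine ⟨fun a => f ⟨min a (w.length - 1), hF a⟩, fun a b hab hb => hf ?_,
      fun a b ha hb hab => (h _ _).1 ?_⟩
    · rw [hF' b hb, hF' a (by omega)]
      exact hab
    · rw [hF' a ha, hF' b hb]
      simpa [hw] using hab
  · rintro ⟨F, hF, h⟩
    refine ⟨fun a => F a, fun a b hab => hF a b hab b.isLt, fun a b => ?_⟩
    simp only [List.get_eq_getElem, hw]
    refine ⟨h a b a.isLt b.isLt, fun hab => ?_⟩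
    by_contra! hba
    rcases hba.lt_or_eq with hba | hba
    · exact hab.asymm (h b a b.isLt a.isLt hba)
    · rw [hc b b.isLt a a.isLt hba] at hab
      exact hab.false

theorem avoidsPattern_321_iff : AvoidsPattern π [3, 2, 1] ↔ Avoids321 π := by
  rw [AvoidsPattern, containsPattern_iff (c := fun a => 3 - a) (m := 3) rfl (by omega)
    (fun a ha => by
      simp only [List.length_cons, List.length_nil] at ha
      interval_cases a <;> rfl) (by omega)]
  constructor
  · intro h i j l hij hjl h1 h2
    refine h ⟨fun a => if a = 0 then i else if a = 1 then j else l, fun a b hab hb => ?_,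
      fun a b ha hb hab => ?_⟩
    · interval_cases b <;> interval_cases a <;> simp [hij, hjl, hij.trans hjl]
    · interval_cases b <;> interval_cases a <;> simp at hab <;> simp [h1, h2, h2.trans h1]
  · rintro h ⟨F, hF, hF'⟩
    exact h (F 0) (F 1) (F 2) (hF _ _ (by omega) (by omega)) (hF _ _ (by omega) (by omega))
      (hF' _ _ (by omega) (by omega) (by omega)) (hF' _ _ (by omega) (by omega) (by omega))

/-- The entries of a word `(q+2)(q+3)⋯(p+q+1) s t 2 3 ⋯ (q+1)`, indexed from zero. -/
def patternEntry (p q s t a : ℕ) : ℕ :=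
  if a < p then q + 2 + a else if a = p then s else if a = p + 1 then t else a - p

theorem containsPattern_patA_iff : ContainsPattern π (X2patA (p + q + 2) (q + 1)) ↔
    ∃ F : ℕ → Fin n, (∀ a b, a < b → b < p + q + 2 → F a < F b) ∧
      ∀ a b, a < p + q + 2 → b < p + q + 2 →
        patternEntry p q 1 (p + q + 2) a < patternEntry p q 1 (p + q + 2) b →
          π (F a) < π (F b) := by
  refine containsPattern_iff ?_ (by omega) ?_ ?_
  · simp [X2patA]
    omega
  · intro a ha
    simp only [X2patA, patternEntry, List.getElem_append, List.getElem_range', List.getElem_cons,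
      List.length_append, List.length_range', List.length_cons, List.length_nil]
    grind
  · intro a ha b hb h
    simp only [patternEntry] at h
    grind

theorem containsPattern_patB_iff : ContainsPattern π (X2patB (p + q + 2) (q + 1)) ↔
    ∃ F : ℕ → Fin n, (∀ a b, a < b → b < p + q + 2 → F a < F b) ∧
      ∀ a b, a < p + q + 2 → b < p + q + 2 →
        patternEntry p q (p + q + 2) 1 a < patternEntry p q (p + q + 2) 1 b →
          π (F a) < π (F b) := by
  refine containsPattern_iff ?_ (by omega) ?_ ?_
  · simp [X2patB]
    omega
  · intro a ha
    simp only [X2patB, patternEntry, List.getElem_append, List.getElem_range', List.getElem_cons,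
      List.length_append, List.length_range', List.length_cons, List.length_nil]
    grind
  · intro a ha b hb h
    simp only [patternEntry] at h
    grind

theorem exists_enumeration {S : Finset (Fin n)} {m : ℕ} (hS : #S = m) (hm : 1 ≤ m) :
    ∃ g : ℕ → Fin n, (∀ a < m, g a ∈ S) ∧ ∀ a b, a < b → b < m → g a < g b := by
  obtain ⟨s, hs⟩ : S.Nonempty := card_pos.1 (by omega)
  refine ⟨fun a => if h : a < m then S.orderEmbOfFin hS ⟨a, h⟩ else s, fun a ha => ?_,
    fun a b hab hb => ?_⟩
  · simp [ha]
  · simp [hb, hab.trans hb, hab]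

theorem hasConfig_iff (hπ : Avoids321 π) (hp : 1 ≤ p) (hq : 1 ≤ q) :
    HasConfig π p q ↔ ContainsPattern π (X2patA (p + q + 2) (q + 1)) ∨
      ContainsPattern π (X2patB (p + q + 2) (q + 1)) := by
  rw [containsPattern_patA_iff, containsPattern_patB_iff]
  have hasConfig_of_seq : ∀ {F : ℕ → Fin n} {x y : Fin n},
      (∀ a b, a < b → b < p + q + 2 → F a < F b) → (∀ a < p, F a < x ∧ F a < y ∧ π (F a) < π y) →
      (∀ b < q, x < F (p + 2 + b) ∧ y < F (p + 2 + b) ∧ π x < π (F (p + 2 + b))) →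
      (∀ a < p, ∀ b < q, π (F (p + 2 + b)) < π (F a)) → HasConfig π p q := by
    intro F x y hF hU hV hUV
    have hinj : ∀ a < p + q + 2, ∀ b < p + q + 2, F a = F b → a = b := by
      intro a ha b hb h
      rcases lt_trichotomy a b with h' | h' | h'
      · exact absurd h (hF a b h' hb).ne
      · exact h'
      · exact absurd h (hF b a h' ha).ne'
    refine ⟨(range p).image F, (range q).image fun b => F (p + 2 + b), x, y, ?_, ?_, ?_, ?_, ?_⟩
    · rw [card_image_of_injOn, card_range]
      intro a ha b hb h
      simp only [coe_range, Set.mem_Iio] at ha hb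
      exact hinj a (by omega) b (by omega) h
    · rw [card_image_of_injOn, card_range]
      intro a ha b hb h
      simp only [coe_range, Set.mem_Iio] at ha hb
      have := hinj (p + 2 + a) (by omega) (p + 2 + b) (by omega) h
      omega
    · simpa using hU
    · simpa using hV
    · simpa using hUV
  constructor
  · rintro ⟨U, V, x, y, hU, hV, hUxy, hVxy, hUV⟩
    obtain ⟨g, hg, hg'⟩ := exists_enumeration hU hp
    obtain ⟨h, hh, hh'⟩ := exists_enumeration hV hq
    have hgπ : ∀ a b, a < b → b < p → π (g a) < π (g b) := fun a b hab hb => by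
      have hv := hh 0 hq
      by_contra! hle
      refine hπ _ _ _ (hg' a b hab hb) ((hUxy _ (hg b hb)).1.trans (hVxy _ hv).1)
        (lt_of_le_of_ne hle fun e => (hg' a b hab hb).ne' (π.injective e)) (hUV _ (hg b hb) _ hv)
    have hhπ : ∀ a b, a < b → b < q → π (h a) < π (h b) := fun a b hab hb => by
      have hu := hg 0 hp
      have ha := hh a (hab.trans hb)
      by_contra! hle
      refine hπ _ _ _ ((hUxy _ hu).1.trans (hVxy _ ha).1) (hh' a b hab hb) (hUV _ hu _ ha)
        (lt_of_le_of_ne hle fun e => (hh' a b hab hb).ne' (π.injective e))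
    have hxy : π x < π y :=
      ((hVxy _ (hh 0 hq)).2.2.trans (hUV _ (hg 0 hp) _ (hh 0 hq))).trans (hUxy _ (hg 0 hp)).2.2
    have hUxy' := fun a ha => hUxy _ (hg a ha)
    have hVxy' := fun a ha => hVxy _ (hh a ha)
    have hUV' := fun a ha b hb => hUV _ (hg a ha) _ (hh b hb)
    have hgh : ∀ a b, a < p → b < q → g a < h b := fun a b ha hb =>
      (hUxy' a ha).1.trans (hVxy' b hb).1
    have hyh : ∀ b < q, π (h b) < π y := fun b hb => (hUV' 0 hp b hb).trans (hUxy' 0 hp).2.2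
    have hxg : ∀ a < p, π x < π (g a) := fun a ha => (hVxy' 0 hq).2.2.trans (hUV' a ha 0 hq)
    rcases lt_trichotomy x y with hlt | rfl | hlt
    · left
      refine ⟨fun a => if a < p then g a else if a = p then x else if a = p + 1 then y else
        h (a - (p + 2)), fun a b hab hb => ?_, fun a b ha hb hab => ?_⟩
      · dsimp only
        split_ifs <;>
          first
          | omega
          | exact hlt
          | exact hg' _ _ (by omega) (by omega)
          | exact hh' _ _ (by omega) (by omega)
          | exact (hUxy' _ (by omega)).1
          | exact (hUxy' _ (by omega)).2.1
          | exact (hVxy' _ (by omega)).1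
          | exact (hVxy' _ (by omega)).2.1
          | exact hgh _ _ (by omega) (by omega)
      · simp only [patternEntry] at hab
        dsimp only
        split_ifs at hab ⊢ <;>
          first
          | omega
          | exact hxy
          | exact hgπ _ _ (by omega) (by omega)
          | exact hhπ _ _ (by omega) (by omega)
          | exact (hUxy' _ (by omega)).2.2
          | exact (hVxy' _ (by omega)).2.2
          | exact hxg _ (by omega)
          | exact hyh _ (by omega)
          | exact hUV' _ (by omega) _ (by omega)
    · exact absurd hxy (lt_irrefl _)
    · right
      refine ⟨fun a => if a < p then g a else if a = p then y else if a = p + 1 then x else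
        h (a - (p + 2)), fun a b hab hb => ?_, fun a b ha hb hab => ?_⟩
      · dsimp only
        split_ifs <;>
          first
          | omega
          | exact hlt
          | exact hg' _ _ (by omega) (by omega)
          | exact hh' _ _ (by omega) (by omega)
          | exact (hUxy' _ (by omega)).1
          | exact (hUxy' _ (by omega)).2.1
          | exact (hVxy' _ (by omega)).1
          | exact (hVxy' _ (by omega)).2.1
          | exact hgh _ _ (by omega) (by omega)
      · simp only [patternEntry] at hab
        dsimp only
        split_ifs at hab ⊢ <;>
          first
          | omega
          | exact hxy
          | exact hgπ _ _ (by omega) (by omega)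
          | exact hhπ _ _ (by omega) (by omega)
          | exact (hUxy' _ (by omega)).2.2
          | exact (hVxy' _ (by omega)).2.2
          | exact hxg _ (by omega)
          | exact hyh _ (by omega)
          | exact hUV' _ (by omega) _ (by omega)
  · rintro (⟨F, hF, hF'⟩ | ⟨F, hF, hF'⟩)
    · refine hasConfig_of_seq (x := F p) (y := F (p + 1)) hF (fun a ha => ⟨?_, ?_, ?_⟩)
        (fun b hb => ⟨?_, ?_, ?_⟩) fun a ha b hb => ?_ <;>
        first
        | exact hF _ _ (by omega) (by omega)
        | exact hF' _ _ (by omega) (by omega) (by grind [patternEntry])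
    · refine hasConfig_of_seq (x := F (p + 1)) (y := F p) hF (fun a ha => ⟨?_, ?_, ?_⟩)
        (fun b hb => ⟨?_, ?_, ?_⟩) fun a ha b hb => ?_ <;>
        first
        | exact hF _ _ (by omega) (by omega)
        | exact hF' _ _ (by omega) (by omega) (by grind [patternEntry])

theorem x2_eq_envCount (hp : 1 ≤ p) (hq : 1 ≤ q) (n : ℕ) :
    x2 (p + q + 2) (q + 1) n = envCount p (q + 1) n := by
  rw [← card_avoiders_eq_envCount hp hq, x2]
  refine Nat.card_congr (Equiv.subtypeEquivRight fun π => ?_)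
  rw [avoidsPattern_321_iff]
  refine and_congr_right fun hπ => ?_
  rw [hasConfig_iff hπ hp hq, not_or, AvoidsPattern, AvoidsPattern]

end Patterns

/-- For `k ≥ 4` and `2 ≤ d ≤ k−2`: for every `n ≥ k`,
`Σ_{j=0}^{k−1} (−1)^j C(k−1−j,j) x_{k,d}^2(n−j)
  = Σ_{j=0}^{k−1} (−1)^j C(k−1−j,j) x_{k,d}^2(n−1−j)
    + Σ_{j=0}^{k−4} (−1)^j C(k−4−j,j) x_{k,d}^2(n−3−j)`,
and for `0 ≤ n ≤ k−1`, `x_{k,d}^2(n) = C(2n,n)/(n+1)`, the `n`-th Catalan number. -/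
theorem x2_recurrence (k d : ℕ) (hk : 4 ≤ k) (hd1 : 2 ≤ d) (hd2 : d ≤ k - 2) :
    (∀ n : ℕ, k ≤ n →
        ∑ j ∈ Finset.range k, (-1 : ℤ)^j * ((k-1-j).choose j : ℤ) * (x2 k d (n-j) : ℤ) =
          (∑ j ∈ Finset.range k, (-1 : ℤ)^j * ((k-1-j).choose j : ℤ) * (x2 k d (n-1-j) : ℤ)) +
            ∑ j ∈ Finset.range (k-3), (-1 : ℤ)^j * ((k-4-j).choose j : ℤ) * (x2 k d (n-3-j) : ℤ)) ∧
      ∀ n : ℕ, n ≤ k - 1 → x2 k d n = Nat.choose (2*n) n / (n+1) := by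
  obtain ⟨p, q, hp, hq, rfl, rfl⟩ : ∃ p q, 1 ≤ p ∧ 1 ≤ q ∧ k = p + q + 2 ∧ d = q + 1 :=
    ⟨k - 1 - d, d - 1, by omega, by omega, by omega, by omega⟩
  have hx : ∀ n, x2 (p + q + 2) (q + 1) n = envCount p (q + 1) n := x2_eq_envCount hp hq
  have hf := isChebQuotient_envCount hp hq
  simp only [hx]
  obtain ⟨m, hm⟩ : ∃ m, p + q = m + 2 := ⟨p + q - 2, by omega⟩
  rw [hm] at hf ⊢
  refine ⟨fun n hn => hf.recurrence hn, fun n hn => ?_⟩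
  rw [hf.2 n (by omega), catalan_eq_centralBinom_div, Nat.centralBinom]
end

section
/- Let k ≥ 4 and 2 ≤ d ≤ k−2. Then for every n ≥ k, Σ_{j=0}^{k} (−1)^j binom(k−j, j) x_{k,d}^3(n−j) = 0, and for every n with 0 ≤ n ≤ k−1, x_{k,d}^3(n) = binom(2n, n)/(n+1), the n-th Catalan number. (Here binom(a,b) denotes the binomial coefficient, equal to 0 when b > a. In particular, x_{k,d}^3(n) satisfies the same recurrence and initial conditions as the number of permutations of {1,…,n} avoiding 321 and (d+1)(d+2)⋯k 1 2 ⋯ d, so the two sets are equinumerous.) -/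
/-- The length-`k` pattern `(d+1)(d+2)⋯(k−1) 1 k 2 3 ⋯ d`. -/
def X3pat (k d : ℕ) : List ℕ :=
  List.range' (d+1) (k-1-d) ++ [1, k] ++ List.range' 2 (d-1)

/-- The length-`k` pattern `(d+1)(d+2)⋯k 1 2 ⋯ d`. -/
def Ypat (k d : ℕ) : List ℕ :=
  List.range' (d+1) (k-d) ++ List.range' 1 d

/-- `x_{k,d}^3(n)`: the number of permutations of `{1,…,n}` avoiding every pattern in
`X_{k,d}^3 = {321, (d+1)⋯(k−1) 1 k 2 3 ⋯ d}`. -/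
noncomputable def x3 (k d n : ℕ) : ℕ :=
  Nat.card {π : Equiv.Perm (Fin n) //
    AvoidsPattern π [3,2,1] ∧ AvoidsPattern π (X3pat k d)}

open DyckStep

namespace PatternCount

/-! ### Tracks of a word -/

/-- The letters of a word at even (`true`) or odd (`false`) indices. -/
def track {β : Type*} : Bool → List β → List β
  | _, [] => []
  | true, x :: l => x :: track false l
  | false, _ :: l => track true l

/-- The alternating shuffle of two words of equal length. -/
def interleave {β : Type*} : List β → List β → List β
  | y :: ys, x :: xs => y :: x :: interleave ys xs
  | _, _ => []

section Tracks

variable {β : Type*}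

@[simp] lemma track_nil (c : Bool) : track c ([] : List β) = [] := by cases c <;> rfl

@[simp] lemma track_true_cons (x : β) (l : List β) : track true (x :: l) = x :: track false l := rfl

@[simp] lemma track_false_cons (x : β) (l : List β) : track false (x :: l) = track true l := rfl

lemma track_append (l₁ l₂ : List β) (c : Bool) :
    track c (l₁ ++ l₂) = track c l₁ ++ track (if Even l₁.length then c else !c) l₂ := by
  induction l₁ generalizing c with
  | nil => simp
  | cons x l ih => cases c <;> by_cases h : Even l.length <;> simp [ih, h, Nat.even_add_one]

lemma track_append_of_even {l₁ : List β} (h : Even l₁.length) (l₂ : List β) (c : Bool) :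
    track c (l₁ ++ l₂) = track c l₁ ++ track c l₂ := by
  rw [track_append, if_pos h]

lemma track_take_two_mul (m : ℕ) (l : List β) (c : Bool) :
    track c (l.take (2 * m)) = (track c l).take m := by
  induction m generalizing l with
  | zero => simp
  | succ m ih =>
    rw [show 2 * (m + 1) = 2 * m + 1 + 1 by ring]
    rcases l with _ | ⟨x, _ | ⟨y, l⟩⟩ <;> cases c <;> simp [ih]

lemma track_true_take_two_mul_add_one (m : ℕ) (l : List β) :
    track true (l.take (2 * m + 1)) = (track true l).take (m + 1) := by
  rcases l with _ | ⟨x, l⟩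
  · simp
  · simp [track_take_two_mul]

lemma track_false_take_two_mul_add_one (m : ℕ) (l : List β) :
    track false (l.take (2 * m + 1)) = (track false l).take m := by
  rcases l with _ | ⟨x, l⟩
  · simp
  · simp [track_take_two_mul]

lemma count_track_add_count_track [DecidableEq β] (a : β) (l : List β) :
    (track true l).count a + (track false l).count a = l.count a := by
  induction l with
  | nil => simp
  | cons x l ih => simp only [track_true_cons, track_false_cons, List.count_cons]; omega

lemma length_track_of_length_eq {m : ℕ} {l : List β} (h : l.length = 2 * m) (c : Bool) :
    (track c l).length = m := by
  induction m generalizing l with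
  | zero => simp [List.length_eq_zero_iff.mp h]
  | succ m ih =>
    rcases l with _ | ⟨x, _ | ⟨y, l⟩⟩
    · simp at h
    · simp at h; omega
    · have := ih (l := l) (by simp at h; omega)
      cases c <;> simp [this]

lemma track_true_interleave {x y : List β} (h : y.length = x.length) :
    track true (interleave y x) = y := by
  induction y generalizing x with
  | nil => simp [interleave]
  | cons a y ih =>
    rcases x with _ | ⟨b, x⟩
    · simp at h
    · simp [interleave, ih (x := x) (by simpa using h)]

lemma track_false_interleave {x y : List β} (h : y.length = x.length) :
    track false (interleave y x) = x := by
  induction y generalizing x with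
  | nil => rw [List.length_nil, eq_comm, List.length_eq_zero_iff] at h; simp [interleave, h]
  | cons a y ih =>
    rcases x with _ | ⟨b, x⟩
    · simp at h
    · simp [interleave, ih (x := x) (by simpa using h)]

lemma interleave_track {m : ℕ} {l : List β} (h : l.length = 2 * m) :
    interleave (track true l) (track false l) = l := by
  induction m generalizing l with
  | zero => simp [List.length_eq_zero_iff.mp h, interleave]
  | succ m ih =>
    rcases l with _ | ⟨x, _ | ⟨y, l⟩⟩
    · simp at h
    · simp at h; omega
    · simp [interleave, ih (l := l) (by simp at h; omega)]

end Tracks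

lemma count_D_add_count_U (l : List DyckStep) : l.count D + l.count U = l.length := by
  induction l with
  | nil => rfl
  | cons x l ih => cases x <;> simp <;> omega

/-! ### Tracks of Dyck words -/

/-- The letters of a Dyck word at even indices. -/
def evens (w : DyckWord) : List DyckStep := track true w.toList

/-- The letters of a Dyck word at odd indices. -/
def odds (w : DyckWord) : List DyckStep := track false w.toList

lemma even_length (w : DyckWord) : Even w.toList.length :=
  ⟨w.semilength, by rw [← w.two_mul_semilength_eq_length]; ring⟩

lemma length_evens (w : DyckWord) : (evens w).length = w.semilength :=
  length_track_of_length_eq w.two_mul_semilength_eq_length.symm _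

lemma length_odds (w : DyckWord) : (odds w).length = w.semilength :=
  length_track_of_length_eq w.two_mul_semilength_eq_length.symm _

lemma count_U_odds (w : DyckWord) : (odds w).count U = (evens w).count D := by
  have h₁ := count_track_add_count_track U w.toList
  have h₂ := count_D_add_count_U (evens w)
  have h₃ := length_evens w
  simp only [odds, evens, DyckWord.semilength] at *
  omega

lemma count_D_odds (w : DyckWord) : (odds w).count D = (evens w).count U := by
  have h₁ := count_U_odds w
  have h₂ := count_D_add_count_U (evens w)
  have h₃ := count_D_add_count_U (odds w)
  rw [length_evens] at h₂
  rw [length_odds] at h₃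
  omega

@[simp] lemma evens_zero : evens 0 = [] := rfl

@[simp] lemma odds_zero : odds 0 = [] := rfl

lemma evens_add (v w : DyckWord) : evens (v + w) = evens v ++ evens w :=
  track_append_of_even (even_length v) _ _

lemma odds_add (v w : DyckWord) : odds (v + w) = odds v ++ odds w :=
  track_append_of_even (even_length v) _ _

lemma evens_nest (w : DyckWord) : evens w.nest = U :: odds w := by
  change track true (U :: (w.toList ++ [D])) = _
  rw [track_true_cons, track_append_of_even (even_length w)]
  simp [odds]

lemma odds_nest (w : DyckWord) : odds w.nest = evens w ++ [D] := by
  change track false (U :: (w.toList ++ [D])) = _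
  rw [track_false_cons, track_append_of_even (even_length w)]
  simp [evens]

lemma dyckWord_ext {v w : DyckWord} (h₁ : odds v = odds w) (h₂ : evens v = evens w) : v = w := by
  ext1
  rw [← interleave_track v.two_mul_semilength_eq_length.symm,
    ← interleave_track w.two_mul_semilength_eq_length.symm]
  simp only [odds, evens] at h₁ h₂
  rw [h₁, h₂]

lemma count_take_evens_le (w : DyckWord) (m : ℕ) :
    ((evens w).take (m + 1)).count D + ((odds w).take m).count D ≤
      ((evens w).take (m + 1)).count U + ((odds w).take m).count U := by
  have h := w.count_D_le_count_U (2 * m + 1)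
  rw [← count_track_add_count_track U, ← count_track_add_count_track D] at h
  simp only [track_true_take_two_mul_add_one, track_false_take_two_mul_add_one] at h
  exact h

/-- The Dyck word with prescribed tracks. -/
def ofTracks (x y : List DyckStep) (hlen : y.length = x.length) (hbal : x.count U = y.count D)
    (hpre : ∀ m < x.length, (y.take (m + 1)).count D ≤ (x.take m).count U) : DyckWord where
  toList := interleave y x
  count_U_eq_count_D := by
    rw [← count_track_add_count_track U, ← count_track_add_count_track D,
      track_true_interleave hlen, track_false_interleave hlen]
    have h₁ := count_D_add_count_U x
    have h₂ := count_D_add_count_U y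
    omega
  count_D_le_count_U i := by
    have key : ∀ m, (y.take m).count D ≤ (x.take m).count U := by
      intro m
      by_cases hm : m < x.length
      · refine le_trans (List.Sublist.count_le _ ?_) (hpre m hm)
        exact (List.take_prefix_take_left (Nat.le_succ m)).sublist
      · rw [List.take_of_length_le (by omega), List.take_of_length_le (by omega), hbal]
    rw [← count_track_add_count_track U, ← count_track_add_count_track D]
    obtain ⟨m, rfl | rfl⟩ := Nat.even_or_odd' i
    · have h₁ := count_D_add_count_U (x.take m)
      have h₂ := count_D_add_count_U (y.take m)
      have h₃ := key m
      simp only [track_take_two_mul, track_true_interleave hlen, track_false_interleave hlen,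
        List.length_take] at *
      omega
    · have h₁ := count_D_add_count_U (x.take m)
      have h₂ := count_D_add_count_U (y.take (m + 1))
      rw [track_true_take_two_mul_add_one, track_false_take_two_mul_add_one,
        track_true_interleave hlen, track_false_interleave hlen]
      simp only [List.length_take] at *
      by_cases hm : m < x.length
      · have h₃ := hpre m hm
        omega
      · rw [List.take_of_length_le (by omega), List.take_of_length_le (by omega)] at *
        omega

lemma odds_ofTracks {x y : List DyckStep} (hlen hbal hpre) :
    odds (ofTracks x y hlen hbal hpre) = x := track_false_interleave hlen

lemma evens_ofTracks {x y : List DyckStep} (hlen hbal hpre) :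
    evens (ofTracks x y hlen hbal hpre) = y := track_true_interleave hlen

lemma semilength_ofTracks {x y : List DyckStep} (hlen hbal hpre) :
    (ofTracks x y hlen hbal hpre).semilength = x.length := by
  rw [← length_odds, odds_ofTracks]

/-! ### Rectangles and dented rectangles between two tracks -/

/-- Some prefixes of `x` and `y` are at least `(p, q)` apart. -/
def RectIn (p q : ℕ) (x y : List DyckStep) : Prop :=
  ∃ s t, s <+: x ∧ t <+: y ∧ t.count D + p ≤ s.count U ∧ s.count D + q ≤ t.count U

/-- Some valley of `x` and some prefix of `y` are at least `(P, Q)` apart. -/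
def DentIn (P Q : ℕ) (x y : List DyckStep) : Prop :=
  ∃ s b t, x = s ++ D :: U :: b ∧ t <+: y ∧
    t.count D + P ≤ s.count U ∧ s.count D + Q + 1 ≤ t.count U

/-- A prefix of `y ++ z` is a prefix of `y`, or `y` followed by a prefix of `z`. -/
lemma prefix_append_cases {β : Type*} {t y z : List β} (h : t <+: y ++ z) :
    t <+: y ∨ ∃ r, r <+: z ∧ t = y ++ r := by
  obtain ⟨u, hu⟩ := h
  rcases List.append_eq_append_iff.mp hu with ⟨a, h₁, -⟩ | ⟨a, h₁, h₂⟩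
  · exact .inl ⟨a, h₁.symm⟩
  · exact .inr ⟨a, ⟨u, h₂.symm⟩, h₁⟩

lemma rectIn_concat_cons (p q : ℕ) (x y : List DyckStep) :
    RectIn p (q + 1) (x ++ [D]) (U :: y) ↔ RectIn q p y x := by
  constructor
  · rintro ⟨s, t, hs, ht, h₁, h₂⟩
    rcases t with _ | ⟨a, t⟩
    · simp at h₂
    obtain ⟨rfl, ht'⟩ := List.cons_prefix_cons.mp ht
    rcases prefix_append_cases hs with hs | ⟨r, hr, rfl⟩
    · refine ⟨t, s, ht', hs, ?_, ?_⟩ <;> simp at h₁ h₂ <;> omega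
    · have hr' := hr.sublist.count_le U
      refine ⟨t, x, ht', List.prefix_rfl, ?_, ?_⟩ <;> simp at h₁ h₂ hr' <;> omega
  · rintro ⟨t, s, ht, hs, h₁, h₂⟩
    refine ⟨s, U :: t, hs.trans (List.prefix_append _ _), List.cons_prefix_cons.mpr ⟨rfl, ht⟩,
      ?_, ?_⟩ <;> simp <;> omega

lemma dentIn_concat_cons (P Q : ℕ) (x y : List DyckStep) :
    DentIn P (Q + 1) (x ++ [D]) (U :: y) ↔ DentIn P Q x y := by
  constructor
  · rintro ⟨s, b, t, hs, ht, h₁, h₂⟩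
    rcases t with _ | ⟨a, t⟩
    · simp at h₂
    obtain ⟨rfl, ht'⟩ := List.cons_prefix_cons.mp ht
    rcases List.eq_nil_or_concat b with rfl | ⟨b, z, rfl⟩
    · have := congrArg List.getLast? hs
      simp at this
    · rw [List.concat_eq_append, show s ++ D :: U :: (b ++ [z]) = (s ++ D :: U :: b) ++ [z] by simp]
        at hs
      obtain ⟨rfl, -⟩ := List.append_inj' hs rfl
      refine ⟨s, b, t, rfl, ht', ?_, ?_⟩ <;> simp at h₁ h₂ <;> omega
  · rintro ⟨s, b, t, rfl, ht, h₁, h₂⟩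
    refine ⟨s, b ++ [D], U :: t, by simp, List.cons_prefix_cons.mpr ⟨rfl, ht⟩, ?_, ?_⟩ <;>
      simp <;> omega

lemma rectIn_append {p q : ℕ} (hp : 0 < p) (hq : 0 < q) {x₁ x₂ y₁ y₂ : List DyckStep}
    (h₁ : x₁.count U = y₁.count D) (h₂ : x₁.count D = y₁.count U) :
    RectIn p q (x₁ ++ x₂) (y₁ ++ y₂) ↔ RectIn p q x₁ y₁ ∨ RectIn p q x₂ y₂ := by
  constructor
  · rintro ⟨s, t, hs, ht, h₃, h₄⟩
    rcases prefix_append_cases hs with hs | ⟨s', hs', rfl⟩ <;>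
    rcases prefix_append_cases ht with ht | ⟨t', ht', rfl⟩
    · exact .inl ⟨s, t, hs, ht, h₃, h₄⟩
    · have := hs.sublist.count_le U
      simp at h₃ h₄
      omega
    · have := ht.sublist.count_le U
      simp at h₃ h₄
      omega
    · refine .inr ⟨s', t', hs', ht', ?_, ?_⟩ <;> simp at h₃ h₄ <;> omega
  · rintro (⟨s, t, hs, ht, h₃, h₄⟩ | ⟨s, t, hs, ht, h₃, h₄⟩)
    · exact ⟨s, t, hs.trans (List.prefix_append _ _), ht.trans (List.prefix_append _ _), h₃, h₄⟩
    · refine ⟨x₁ ++ s, y₁ ++ t, (List.prefix_append_right_inj _).mpr hs,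
        (List.prefix_append_right_inj _).mpr ht, ?_, ?_⟩ <;> simp <;> omega

lemma dentIn_append {P Q : ℕ} (hP : 0 < P) (hQ : 0 < Q) {x₁ x₂ y₁ y₂ : List DyckStep}
    (h₁ : x₁.count U = y₁.count D) (h₂ : x₁.count D = y₁.count U) :
    DentIn P Q (x₁ ++ x₂) (y₁ ++ y₂) ↔ DentIn P Q x₁ y₁ ∨ DentIn P Q x₂ y₂ := by
  constructor
  · rintro ⟨s, b, t, hs, ht, h₃, h₄⟩
    rcases List.append_eq_append_iff.mp hs with ⟨r, rfl, hr⟩ | ⟨r, rfl, hr⟩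
    · rcases prefix_append_cases ht with ht | ⟨t', ht', rfl⟩
      · have := ht.sublist.count_le U
        simp at h₃ h₄
        omega
      · refine .inr ⟨r, b, t', hr, ht', ?_, ?_⟩ <;> simp at h₃ h₄ <;> omega
    · rcases r with _ | ⟨a, _ | ⟨a', r⟩⟩
      · rcases prefix_append_cases ht with ht | ⟨t', ht', rfl⟩
        · have := ht.sublist.count_le U
          simp at h₃ h₄ h₁ h₂
          omega
        · simp at h₃ h₄ h₁ h₂ hr
          refine .inr ⟨[], b, t', by simp [hr], ht', ?_, ?_⟩ <;> simp <;> omega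
      · simp at hr
        obtain ⟨rfl, hr⟩ := hr
        rcases prefix_append_cases ht with ht | ⟨t', ht', rfl⟩
        · have := ht.sublist.count_le U
          simp at h₃ h₄ h₁ h₂
          omega
        · simp at h₃ h₄ h₁ h₂
          omega
      · simp at hr
        obtain ⟨rfl, rfl, hr⟩ := hr
        rcases prefix_append_cases ht with ht | ⟨t', ht', rfl⟩
        · exact .inl ⟨s, r, t, by simp, ht, h₃, h₄⟩
        · simp at h₃ h₄ h₁ h₂
          omega
  · rintro (⟨s, b, t, rfl, ht, h₃, h₄⟩ | ⟨s, b, t, rfl, ht, h₃, h₄⟩)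
    · exact ⟨s, b ++ x₂, t, by simp, ht.trans (List.prefix_append _ _), h₃, h₄⟩
    · refine ⟨x₁ ++ s, b, y₁ ++ t, by simp,
        (List.prefix_append_right_inj _).mpr ht, ?_, ?_⟩ <;> simp <;> omega

/-! ### Reversal -/

/-- The other letter. -/
def flip : DyckStep → DyckStep
  | U => D
  | D => U

@[simp] lemma flip_U : flip U = D := rfl

@[simp] lemma flip_D : flip D = U := rfl

@[simp] lemma flip_flip (a : DyckStep) : flip (flip a) = a := by cases a <;> rfl

/-- Read a word backwards with `U` and `D` exchanged. -/
def mirror (l : List DyckStep) : List DyckStep := (l.map flip).reverse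

@[simp] lemma mirror_mirror (l : List DyckStep) : mirror (mirror l) = l := by
  simp [mirror, Function.comp_def]

@[simp] lemma length_mirror (l : List DyckStep) : (mirror l).length = l.length := by simp [mirror]

@[simp] lemma mirror_append (l₁ l₂ : List DyckStep) :
    mirror (l₁ ++ l₂) = mirror l₂ ++ mirror l₁ := by simp [mirror]

@[simp] lemma mirror_cons (a : DyckStep) (l : List DyckStep) :
    mirror (a :: l) = mirror l ++ [flip a] := by simp [mirror]

@[simp] lemma count_mirror (a : DyckStep) (l : List DyckStep) :
    (mirror l).count a = l.count (flip a) := by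
  induction l with
  | nil => rfl
  | cons x l ih => cases x <;> cases a <;> simp_all [mirror_cons]

lemma track_mirror {m : ℕ} {l : List DyckStep} (h : l.length = 2 * m) (c : Bool) :
    track c (mirror l) = mirror (track (!c) l) := by
  induction m generalizing l with
  | zero => simp [List.length_eq_zero_iff.mp h, mirror]
  | succ m ih =>
    rcases l with _ | ⟨x, _ | ⟨y, l⟩⟩
    · simp at h
    · simp at h; omega
    · have hl : l.length = 2 * m := by simp at h; omega
      have he : Even (mirror l).length := by simp [hl]
      rw [mirror_cons, mirror_cons, List.append_assoc, track_append_of_even he, ih hl]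
      cases c <;> simp

/-- The reversal of a Dyck path. -/
def rev (w : DyckWord) : DyckWord where
  toList := mirror w.toList
  count_U_eq_count_D := by simp [w.count_U_eq_count_D]
  count_D_le_count_U i := by
    have h₁ : (mirror w.toList).take i = mirror (w.toList.drop (w.toList.length - i)) := by
      simp [mirror, List.take_reverse]
    have h₂ := w.count_D_le_count_U (w.toList.length - i)
    have h₃ := w.count_U_eq_count_D
    rw [← List.take_append_drop (w.toList.length - i) w.toList, List.count_append,
      List.count_append] at h₃
    rw [h₁]
    simp
    omega

@[simp] lemma rev_rev (w : DyckWord) : rev (rev w) = w := by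
  ext1
  simp [rev]

@[simp] lemma semilength_rev (w : DyckWord) : (rev w).semilength = w.semilength := by
  rw [DyckWord.semilength_eq_count_D]
  simp [rev, DyckWord.semilength]

lemma odds_rev (w : DyckWord) : odds (rev w) = mirror (evens w) :=
  track_mirror w.two_mul_semilength_eq_length.symm false

lemma evens_rev (w : DyckWord) : evens (rev w) = mirror (odds w) :=
  track_mirror w.two_mul_semilength_eq_length.symm true

lemma DentIn.mirror {P Q : ℕ} {x y : List DyckStep} (h₁ : x.count U = y.count D)
    (h₂ : x.count D = y.count U) (h : DentIn P Q x y) : DentIn Q P (mirror x) (mirror y) := by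
  obtain ⟨s, b, t, rfl, ⟨r, rfl⟩, h₃, h₄⟩ := h
  refine ⟨PatternCount.mirror b, PatternCount.mirror s, PatternCount.mirror r, by simp,
    by simp, ?_, ?_⟩ <;> simp at * <;> omega

lemma dentIn_rev (P Q : ℕ) (w : DyckWord) :
    DentIn P Q (evens (rev w)) (odds (rev w)) ↔ DentIn Q P (odds w) (evens w) := by
  rw [evens_rev, odds_rev]
  constructor
  · intro h
    simpa using h.mirror (by simp [count_D_odds]) (by simp [count_U_odds])
  · exact fun h => h.mirror (count_U_odds w) (count_D_odds w)

/-! ### Generating functions -/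

open PowerSeries in
/-- The polynomials `∑ⱼ (-1)ʲ C(k-j, j) Xʲ`, defined by their three-term recurrence. -/
noncomputable def continuant : ℕ → PowerSeries ℤ
  | 0 => 1
  | 1 => 1
  | k + 2 => continuant (k + 1) - X * continuant k

lemma coeff_continuant (k j : ℕ) :
    PowerSeries.coeff j (continuant k) = (-1) ^ j * ((k - j).choose j : ℤ) := by
  induction k using Nat.twoStepInduction generalizing j with
  | zero => cases j <;> simp [continuant, PowerSeries.coeff_one]
  | one =>
    rcases j with _ | _ | j <;> simp [continuant, PowerSeries.coeff_one]
  | more k ih₁ ih₂ =>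
    rw [continuant, map_sub]
    rcases j with _ | j
    · simp [ih₂]
    · rw [PowerSeries.coeff_succ_X_mul, ih₁, ih₂]
      by_cases hj : j ≤ k
      · rw [show k + 2 - (j + 1) = (k - j) + 1 by omega, show k + 1 - (j + 1) = k - j by omega,
          Nat.choose_succ_succ]
        push_cast
        ring
      · rw [show k + 2 - (j + 1) = 0 by omega, show k + 1 - (j + 1) = 0 by omega,
          show k - j = 0 by omega]
        obtain ⟨i, rfl⟩ : ∃ i, j = i + 1 := ⟨j - 1, by omega⟩
        simp

lemma continuant_ne_zero (k : ℕ) : continuant k ≠ 0 := by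
  intro h
  have := coeff_continuant k 0
  simp [h] at this

/-- `F` is the quotient `continuant m / continuant (m + 1)`. -/
def IsConvergent (m : ℕ) (F : PowerSeries ℤ) : Prop := F * continuant (m + 1) = continuant m

lemma IsConvergent.unique {m : ℕ} {F G : PowerSeries ℤ} (hF : IsConvergent m F)
    (hG : IsConvergent m G) : F = G :=
  mul_right_cancel₀ (continuant_ne_zero (m + 1)) (hF.trans hG.symm)

lemma IsConvergent.succ {m : ℕ} {F G : PowerSeries ℤ} (hF : IsConvergent m F)
    (hG : G = 1 + PowerSeries.X * F * G) : IsConvergent (m + 1) G := by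
  unfold IsConvergent at *
  rw [continuant, ← hF]
  linear_combination continuant (m + 1) * hG

lemma isConvergent_zero : IsConvergent 0 1 := by simp [IsConvergent, continuant]

/-- The counts of Dyck words with property `P`, by semilength. -/
noncomputable def gf (P : DyckWord → Prop) : PowerSeries ℤ :=
  PowerSeries.mk fun n => (Nat.card {w : DyckWord // w.semilength = n ∧ P w} : ℤ)

instance (n : ℕ) (P : DyckWord → Prop) : Finite {w : DyckWord // w.semilength = n ∧ P w} :=
  Finite.of_injective (fun w => (⟨w.1, w.2.1⟩ : {w : DyckWord // w.semilength = n}))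
    fun v w h => Subtype.ext (by simpa using h)

lemma semilength_eq_zero {w : DyckWord} : w.semilength = 0 ↔ w = 0 := by
  rw [← DyckWord.toList_eq_nil, ← List.length_eq_zero_iff, ← w.two_mul_semilength_eq_length]
  omega

/-- Splitting Dyck words at their first return. -/
noncomputable def firstReturnEquiv {P P' P'' : DyckWord → Prop}
    (h : ∀ a b, P (a.nest + b) ↔ P' a ∧ P'' b) (n : ℕ) :
    (Σ ij : Finset.HasAntidiagonal.antidiagonal n,
      {a : DyckWord // a.semilength = ij.1.1 ∧ P' a} ×
        {b : DyckWord // b.semilength = ij.1.2 ∧ P'' b}) ≃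
      {w : DyckWord // w.semilength = n + 1 ∧ P w} :=
  Equiv.ofBijective
    (fun x => ⟨x.2.1.1.nest + x.2.2.1, by
      have h₁ := x.2.1.2.1
      have h₂ := x.2.2.2.1
      have h₃ := Finset.HasAntidiagonal.mem_antidiagonal.mp x.1.2
      simp only [DyckWord.semilength_add, DyckWord.semilength_nest]
      omega, (h _ _).mpr ⟨x.2.1.2.2, x.2.2.2.2⟩⟩) <| by
    constructor
    · rintro ⟨⟨⟨i, j⟩, hij⟩, ⟨a, hi, ha⟩, ⟨b, hj, hb⟩⟩
        ⟨⟨⟨i', j'⟩, hij'⟩, ⟨a', hi', ha'⟩, ⟨b', hj', hb'⟩⟩ e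
      have e : a.nest + b = a'.nest + b' := congrArg Subtype.val e
      have h₁ : a = a' := by simpa using congrArg DyckWord.insidePart e
      have h₂ : b = b' := by simpa using congrArg DyckWord.outsidePart e
      dsimp only at hi hj hi' hj'
      subst h₁ h₂ hi hj hi' hj'
      rfl
    · rintro ⟨w, hw, hP⟩
      have h0 : w ≠ 0 := fun h => by simp [h] at hw
      have hl := DyckWord.semilength_insidePart_add_semilength_outsidePart_add_one h0
      have hP' := (h w.insidePart w.outsidePart).mp
        (by rw [DyckWord.nest_insidePart_add_outsidePart h0]; exact hP)
      refine ⟨⟨⟨(w.insidePart.semilength, w.outsidePart.semilength), ?_⟩,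
        ⟨w.insidePart, rfl, hP'.1⟩, ⟨w.outsidePart, rfl, hP'.2⟩⟩,
        Subtype.ext (DyckWord.nest_insidePart_add_outsidePart h0)⟩
      rw [Finset.HasAntidiagonal.mem_antidiagonal]
      omega

lemma gf_eq_one_add {P P' P'' : DyckWord → Prop} (h0 : P 0)
    (h : ∀ a b, P (a.nest + b) ↔ P' a ∧ P'' b) :
    gf P = 1 + PowerSeries.X * gf P' * gf P'' := by
  ext n
  rcases n with _ | n
  · have : Nat.card {w : DyckWord // w.semilength = 0 ∧ P w} = 1 := by
      rw [Nat.card_eq_one_iff_unique]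
      refine ⟨⟨fun v w => Subtype.ext ?_⟩, ⟨0, rfl, h0⟩⟩
      rw [semilength_eq_zero.mp v.2.1, semilength_eq_zero.mp w.2.1]
    simp [gf, this]
  · rw [map_add, mul_assoc, PowerSeries.coeff_succ_X_mul, PowerSeries.coeff_mul]
    simp only [gf, PowerSeries.coeff_mk]
    rw [← Nat.card_congr (firstReturnEquiv h n), Nat.card_sigma, PowerSeries.coeff_one]
    simp only [Nat.card_prod]
    rw [Finset.sum_coe_sort (Finset.HasAntidiagonal.antidiagonal n) fun ij =>
      Nat.card {a : DyckWord // a.semilength = ij.1 ∧ P' a} *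
        Nat.card {b : DyckWord // b.semilength = ij.2 ∧ P'' b}]
    simp

lemma gf_congr {P P' : DyckWord → Prop} (h : ∀ w, P w ↔ P' w) : gf P = gf P' := by
  rw [show P = P' from funext fun w => propext (h w)]

lemma gf_rev (P : DyckWord → Prop) : gf (fun w => P (rev w)) = gf P := by
  ext n
  simp only [gf, PowerSeries.coeff_mk]
  congr 1
  exact Nat.card_congr ⟨fun w => ⟨rev w.1, by simpa using w.2⟩,
    fun w => ⟨rev w.1, by simpa using w.2⟩,
    fun w => by simp, fun w => by simp⟩

lemma gf_eq_zero : gf (· = 0) = 1 := by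
  ext n
  simp only [gf, PowerSeries.coeff_mk, PowerSeries.coeff_one]
  split_ifs with hn
  · have : Nat.card {w : DyckWord // w.semilength = n ∧ w = 0} = 1 := by
      rw [Nat.card_eq_one_iff_unique]
      exact ⟨⟨fun v w => Subtype.ext (v.2.2.trans w.2.2.symm)⟩, ⟨0, hn.symm, rfl⟩⟩
    simp [this]
  · have : IsEmpty {w : DyckWord // w.semilength = n ∧ w = 0} :=
      ⟨fun ⟨w, h₁, h₂⟩ => hn (by simpa [h₂] using h₁.symm)⟩
    simp

/-! ### Recursions for the two families of Dyck words -/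

/-- Dyck words without a `p × q` rectangle between their tracks. -/
def RectFree (p q : ℕ) (w : DyckWord) : Prop := ¬ RectIn p q (odds w) (evens w)

/-- Dyck words without a dented rectangle between their tracks. -/
def DentFree (P Q : ℕ) (w : DyckWord) : Prop := ¬ DentIn P Q (odds w) (evens w)

lemma rectFree_nest_add {p q : ℕ} (hp : 0 < p) (a b : DyckWord) :
    RectFree p (q + 1) (a.nest + b) ↔ RectFree q p a ∧ RectFree p (q + 1) b := by
  rw [RectFree, odds_add, evens_add,
    rectIn_append hp q.succ_pos (count_U_odds a.nest) (count_D_odds a.nest), odds_nest, evens_nest,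
    rectIn_concat_cons, not_or]
  rfl

lemma dentFree_nest_add {P Q : ℕ} (hP : 0 < P) (a b : DyckWord) :
    DentFree P (Q + 1) (a.nest + b) ↔
      ¬ DentIn P Q (evens a) (odds a) ∧ DentFree P (Q + 1) b := by
  rw [DentFree, odds_add, evens_add,
    dentIn_append hP Q.succ_pos (count_U_odds a.nest) (count_D_odds a.nest), odds_nest, evens_nest,
    dentIn_concat_cons, not_or]
  rfl

lemma gf_rectFree {p q : ℕ} (hp : 0 < p) :
    gf (RectFree p (q + 1)) =
      1 + PowerSeries.X * gf (RectFree q p) * gf (RectFree p (q + 1)) := by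
  refine gf_eq_one_add ?_ (rectFree_nest_add hp)
  rintro ⟨s, t, hs, ht, h₁, h₂⟩
  simp_all

lemma gf_not_dentIn_evens (P Q : ℕ) :
    gf (fun w => ¬ DentIn P Q (evens w) (odds w)) = gf (DentFree Q P) := by
  rw [← gf_rev]
  exact gf_congr fun w => not_congr (dentIn_rev P Q w)

lemma gf_dentFree {P Q : ℕ} (hP : 0 < P) :
    gf (DentFree P (Q + 1)) =
      1 + PowerSeries.X * gf (DentFree Q P) * gf (DentFree P (Q + 1)) := by
  rw [← gf_not_dentIn_evens P Q]
  refine gf_eq_one_add ?_ (dentFree_nest_add hP)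
  rintro ⟨s, b, t, hs, -⟩
  simp at hs

/-! ### Base cases -/

lemma evens_eq_cons {w : DyckWord} (hw : w ≠ 0) : ∃ l, evens w = U :: l := by
  rw [← DyckWord.nest_insidePart_add_outsidePart hw, evens_add, evens_nest]
  exact ⟨_, rfl⟩

lemma rectFree_zero_one_iff (w : DyckWord) : RectFree 0 1 w ↔ w = 0 := by
  constructor
  · intro h
    by_contra hw
    obtain ⟨l, hl⟩ := evens_eq_cons hw
    exact h ⟨[], [U], by simp, by simp [hl], by simp, by simp⟩
  · rintro rfl ⟨s, t, hs, ht, h₁, h₂⟩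
    simp_all

lemma isConvergent_gf_rectFree_one_one : IsConvergent 1 (gf (RectFree 1 1)) := by
  refine isConvergent_zero.succ ?_
  conv_lhs => rw [gf_rectFree one_pos, gf_congr rectFree_zero_one_iff, gf_eq_zero]

/-- Words of the form `U … U D … D`. -/
abbrev NoValley (l : List DyckStep) : Prop := l.IsChain fun a b => a = D → b = D

lemma noValley_iff (l : List DyckStep) : NoValley l ↔ ∀ s b, l ≠ s ++ D :: U :: b := by
  rw [NoValley, List.isChain_iff_forall_rel_of_append_cons_cons]
  constructor
  · intro h s b hl
    simpa using h hl
  · rintro h a c s b hl rfl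
    cases c
    · exact absurd hl (h s b)
    · rfl

lemma noValley_cons_D (l : List DyckStep) : NoValley (D :: l) ↔ ∀ a ∈ l, a = D := by
  induction l with
  | nil => simp [NoValley]
  | cons x l ih =>
    rw [NoValley, List.isChain_cons_cons]
    constructor
    · rintro ⟨h₁, h₂⟩
      obtain rfl := h₁ rfl
      simpa using ih.mp h₂
    · intro h
      obtain rfl := h x (by simp)
      exact ⟨fun _ => rfl, ih.mpr fun a ha => h a (by simp [ha])⟩

lemma noValley_odds_nest_add (a b : DyckWord) :
    NoValley (odds (a.nest + b)) ↔ NoValley (evens a) ∧ ∀ c ∈ odds b, c = D := by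
  rw [odds_add, odds_nest, ← noValley_cons_D, NoValley, List.append_assoc, List.singleton_append,
    List.isChain_append]
  simp

lemma odds_nest_add_eq_D (a b : DyckWord) :
    (∀ c ∈ odds (a.nest + b), c = D) ↔ a = 0 ∧ ∀ c ∈ odds b, c = D := by
  rw [odds_add, odds_nest]
  simp only [List.mem_append, List.mem_singleton, or_imp, forall_and, forall_eq, and_true]
  refine and_congr_left fun _ => ⟨fun h => ?_, fun h => by simp [h]⟩
  by_contra ha
  obtain ⟨l, hl⟩ := evens_eq_cons ha
  simpa using h U (by simp [hl])

lemma not_dentIn_one_zero_iff (w : DyckWord) :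
    ¬ DentIn 1 0 (evens w) (odds w) ↔ NoValley (evens w) := by
  rw [noValley_iff]
  constructor
  · intro h s b hs
    refine h ⟨s, b, (odds w).take s.length, hs, List.take_prefix _ _, ?_⟩
    have h₁ := count_take_evens_le w s.length
    have h₂ := count_D_add_count_U s
    have h₃ := count_D_add_count_U ((odds w).take s.length)
    have h₄ : (evens w).length = (odds w).length := by rw [length_evens, length_odds]
    rw [List.length_take, ← h₄, hs] at h₃
    have h₅ : (evens w).take (s.length + 1) = s ++ [D] := by
      rw [hs, List.take_append]
      simp
    rw [h₅] at h₁
    simp at h₁ h₃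
    omega
  · rintro h ⟨s, b, t, hs, -⟩
    exact h s b hs

lemma isConvergent_gf_dentFree_one_one : IsConvergent 3 (gf (DentFree 1 1)) := by
  have h₁ : gf (fun w => ∀ c ∈ odds w, c = D) =
      1 + PowerSeries.X * 1 * gf (fun w => ∀ c ∈ odds w, c = D) := by
    have h := gf_eq_one_add (P := fun w => ∀ c ∈ odds w, c = D) (by simp) odds_nest_add_eq_D
    rwa [gf_eq_zero] at h
  have h₂ : gf (fun w => NoValley (evens w)) = gf (fun w => NoValley (odds w)) := by
    rw [← gf_rev]
    refine gf_congr fun w => ?_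
    rw [evens_rev, mirror, NoValley, List.isChain_reverse, List.isChain_map]
    congr! 3 with a
    ext b
    cases a <;> cases b <;> simp
  have h₃ : gf (fun w => NoValley (odds w)) = 1 + PowerSeries.X * gf (fun w => NoValley (evens w)) *
      gf (fun w => ∀ c ∈ odds w, c = D) := by
    refine gf_eq_one_add (by simp [NoValley]) noValley_odds_nest_add
  have h₄ : IsConvergent 2 (gf (fun w => NoValley (evens w))) := by
    refine (isConvergent_zero.succ h₁).succ ?_
    rw [h₂] at h₃ ⊢
    linear_combination h₃
  refine h₄.succ ?_
  have h₅ := gf_dentFree (P := 1) (Q := 0) one_pos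
  rwa [← gf_not_dentIn_evens 1 0, gf_congr not_dentIn_one_zero_iff] at h₅

theorem isConvergent_gf_rectFree
    (swap : ∀ p q, 0 < p → 0 < q → gf (RectFree p q) = gf (RectFree q p)) (p q : ℕ) :
    IsConvergent (p + q + 1) (gf (RectFree (p + 1) (q + 1))) := by
  obtain ⟨m, hm⟩ : ∃ m, p + q = m := ⟨_, rfl⟩
  induction m generalizing p q with
  | zero =>
    obtain ⟨rfl, rfl⟩ : p = 0 ∧ q = 0 := by omega
    exact isConvergent_gf_rectFree_one_one
  | succ m ih =>
    have step : ∀ p q, p + (q + 1) = m + 1 →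
        IsConvergent (p + (q + 1) + 1) (gf (RectFree (p + 1) (q + 1 + 1))) := by
      intro p q h
      have := ih q p (by omega)
      rw [show p + (q + 1) + 1 = (q + p + 1) + 1 by omega]
      exact this.succ (gf_rectFree p.succ_pos)
    rcases q with _ | q
    · rcases p with _ | p
      · omega
      · rw [swap _ _ (by omega) (by omega)]
        simpa using step 0 p (by omega)
    · exact step p q hm

theorem isConvergent_gf_dentFree
    (swap : ∀ p q, 0 < p → 0 < q → gf (DentFree p q) = gf (DentFree q p)) (p q : ℕ) :
    IsConvergent (p + q + 3) (gf (DentFree (p + 1) (q + 1))) := by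
  obtain ⟨m, hm⟩ : ∃ m, p + q = m := ⟨_, rfl⟩
  induction m generalizing p q with
  | zero =>
    obtain ⟨rfl, rfl⟩ : p = 0 ∧ q = 0 := by omega
    exact isConvergent_gf_dentFree_one_one
  | succ m ih =>
    have step : ∀ p q, p + (q + 1) = m + 1 →
        IsConvergent (p + (q + 1) + 3) (gf (DentFree (p + 1) (q + 1 + 1))) := by
      intro p q h
      have := ih q p (by omega)
      rw [show p + (q + 1) + 3 = (q + p + 3) + 1 by omega]
      exact this.succ (gf_dentFree p.succ_pos)
    rcases q with _ | q
    · rcases p with _ | p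
      · omega
      · rw [swap _ _ (by omega) (by omega)]
        simpa using step 0 p (by omega)
    · exact step p q hm

lemma IsConvergent.sum_eq_zero {k : ℕ} {a : ℕ → ℕ}
    (h : IsConvergent (k - 1) (PowerSeries.mk fun n => (a n : ℤ))) (hk : 1 ≤ k) {n : ℕ}
    (hn : k ≤ n) :
    ∑ j ∈ Finset.range (k + 1), (-1 : ℤ) ^ j * ((k - j).choose j : ℤ) * (a (n - j) : ℤ) = 0 := by
  unfold IsConvergent at h
  rw [Nat.sub_add_cancel hk] at h
  have h' := congrArg (PowerSeries.coeff n) h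
  rw [coeff_continuant, Nat.choose_eq_zero_of_lt (by omega), mul_comm, PowerSeries.coeff_mul,
    Finset.Nat.sum_antidiagonal_eq_sum_range_succ_mk] at h'
  simp only [coeff_continuant, PowerSeries.coeff_mk, Nat.cast_zero, mul_zero] at h'
  rw [← h']
  refine Finset.sum_subset (by simpa using hn) fun j _ hj => ?_
  rw [Nat.choose_eq_zero_of_lt (by simp at hj; omega)]
  simp

/-! ### Permutations without decreasing triples -/

section Permutations

variable {n : ℕ}

/-- A permutation with no decreasing subsequence of length three. -/
def NoTriple (α : Equiv.Perm (Fin n)) : Prop :=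
  ∀ i j l, i < j → j < l → ¬ (α l < α j ∧ α j < α i)

lemma exists_gt_of_lt_apply (α : Equiv.Perm (Fin n)) {j : Fin n} (hj : j < α j) :
    ∃ l, j < l ∧ α l ≤ j := by
  by_contra! h
  have : (Finset.Ici j).card ≤ (Finset.Ioi j).card := by
    refine Finset.card_le_card_of_injOn α (fun l hl => ?_) α.injective.injOn
    rw [Finset.mem_coe, Finset.mem_Ici] at hl
    rw [Finset.mem_coe, Finset.mem_Ioi]
    rcases hl.eq_or_lt with rfl | hl
    · exact hj
    · exact h l hl
  rw [Fin.card_Ici, Fin.card_Ioi] at this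
  omega

lemma exists_lt_of_apply_le (α : Equiv.Perm (Fin n)) {i j : Fin n} (hi : α i ≤ i) (hij : i < j)
    (hα : α j < α i) : ∃ l, l < i ∧ α i < α l := by
  by_contra! h
  have hj : j ∉ Finset.Iic i := by simpa using hij
  have : (insert j (Finset.Iic i)).card ≤ (Finset.Iic (α i)).card := by
    refine Finset.card_le_card_of_injOn α (fun l hl => ?_) α.injective.injOn
    rw [Finset.mem_coe, Finset.mem_insert, Finset.mem_Iic] at hl
    rw [Finset.mem_coe, Finset.mem_Iic]
    rcases hl with rfl | hl
    · exact hα.le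
    · rcases hl.eq_or_lt with rfl | hl
      · exact le_rfl
      · exact h l hl
  rw [Finset.card_insert_of_notMem hj, Fin.card_Iic, Fin.card_Iic] at this
  have : (α i : ℕ) ≤ i := hi
  omega

lemma NoTriple.lt_apply {α : Equiv.Perm (Fin n)} (h : NoTriple α) {i j : Fin n} (hij : i < j)
    (hα : α j < α i) : i < α i := by
  by_contra! hi
  obtain ⟨l, hl, hl'⟩ := exists_lt_of_apply_le α hi hij hα
  exact h l i j hl hij ⟨hα, hl'⟩

lemma NoTriple.apply_le {α : Equiv.Perm (Fin n)} (h : NoTriple α) {i j : Fin n} (hij : i < j)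
    (hα : α j < α i) : α j ≤ j := by
  by_contra! hj
  obtain ⟨l, hl, hl'⟩ := exists_gt_of_lt_apply α hj
  exact h i j l hij hl ⟨hl'.trans_lt hj, hα⟩

lemma NoTriple.strictMonoOn_lt {α : Equiv.Perm (Fin n)} (h : NoTriple α) :
    StrictMonoOn α {i | i < α i} := by
  intro i _ j hj hij
  by_contra! hα
  have hα := hα.lt_of_ne fun e => hij.ne' (α.injective e)
  exact (h.apply_le hij hα).not_gt hj

lemma NoTriple.strictMonoOn_le {α : Equiv.Perm (Fin n)} (h : NoTriple α) :
    StrictMonoOn α {i | α i ≤ i} := by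
  intro i hi j _ hij
  by_contra! hα
  have hα := hα.lt_of_ne fun e => hij.ne' (α.injective e)
  exact (h.lt_apply hij hα).not_ge hi

lemma noTriple_of_strictMonoOn {α : Equiv.Perm (Fin n)} {p : Fin n → Prop}
    (h₁ : StrictMonoOn α {i | p i}) (h₂ : StrictMonoOn α {i | ¬ p i}) : NoTriple α := by
  rintro i j l hij hjl ⟨hlj, hji⟩
  by_cases pi : p i <;> by_cases pj : p j <;> by_cases pl : p l
  · exact (h₁ pi pj hij).not_gt hji
  · exact (h₁ pi pj hij).not_gt hji
  · exact (h₁ pi pl (hij.trans hjl)).not_gt (hlj.trans hji)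
  · exact (h₂ pj pl hjl).not_gt hlj
  · exact (h₁ pj pl hjl).not_gt hlj
  · exact (h₂ pi pl (hij.trans hjl)).not_gt (hlj.trans hji)
  · exact (h₂ pi pj hij).not_gt hji
  · exact (h₂ pi pj hij).not_gt hji

/-! ### The Dyck word of a permutation -/

lemma count_take_ofFn {β : Type*} [DecidableEq β] (f : Fin n → β) (m : ℕ) (a : β) :
    ((List.ofFn f).take m).count a =
      (Finset.univ.filter fun i : Fin n => i.1 < m ∧ f i = a).card := by
  induction m with
  | zero => simp
  | succ m ih =>
    by_cases hm : m < n
    · rw [List.take_succ_eq_append_getElem (by simpa using hm), List.count_append, ih]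
      by_cases ha : f ⟨m, hm⟩ = a
      · rw [show (Finset.univ.filter fun i : Fin n => i.1 < m + 1 ∧ f i = a) =
            insert ⟨m, hm⟩ (Finset.univ.filter fun i : Fin n => i.1 < m ∧ f i = a) from ?_,
          Finset.card_insert_of_notMem (by simp)]
        · simp [ha]
        · ext i
          simp only [Finset.mem_filter, Finset.mem_univ, true_and, Finset.mem_insert, Fin.ext_iff]
          constructor
          · rintro ⟨h, h'⟩
            by_cases e : i.1 = m
            · exact Or.inl e
            · exact Or.inr ⟨by omega, h'⟩
          · rintro (h | h)
            · exact ⟨by omega, by rw [← ha]; congr 1; exact Fin.ext h⟩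
            · exact ⟨by omega, h.2⟩
      · rw [List.getElem_ofFn, List.count_singleton, if_neg (by simpa using ha), add_zero]
        congr 1
        ext i
        simp only [Finset.mem_filter, Finset.mem_univ, true_and]
        constructor
        · exact fun h => ⟨by omega, h.2⟩
        · refine fun h => ⟨lt_of_le_of_ne (by omega) fun e => ha ?_, h.2⟩
          rw [← h.2]; congr 1; exact Fin.ext e.symm
    · rw [List.take_of_length_le (by simp; omega)]
      rw [List.take_of_length_le (by simp; omega)] at ih
      rw [ih]
      congr 1
      ext i
      have := i.2
      simp only [Finset.mem_filter, Finset.mem_univ, true_and]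
      exact and_congr_left fun _ => by omega

/-- The word marking the positions `i` with `i < α i`. -/
def posWord (α : Equiv.Perm (Fin n)) : List DyckStep :=
  List.ofFn fun i => if i < α i then U else D

/-- The word marking the values `v` with `α⁻¹ v < v`. -/
def valWord (α : Equiv.Perm (Fin n)) : List DyckStep :=
  List.ofFn fun v => if α.symm v < v then D else U

lemma count_U_take_posWord (α : Equiv.Perm (Fin n)) (m : ℕ) : ((posWord α).take m).count U =
    (Finset.univ.filter fun i : Fin n => i.1 < m ∧ i < α i).card := by
  rw [posWord, count_take_ofFn]
  congr! 3 with i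
  split_ifs <;> simp_all

lemma count_D_take_posWord (α : Equiv.Perm (Fin n)) (m : ℕ) : ((posWord α).take m).count D =
    (Finset.univ.filter fun i : Fin n => i.1 < m ∧ α i ≤ i).card := by
  rw [posWord, count_take_ofFn]
  congr! 3 with i
  split_ifs <;> simp_all

lemma count_D_take_valWord (α : Equiv.Perm (Fin n)) (m : ℕ) : ((valWord α).take m).count D =
    (Finset.univ.filter fun i : Fin n => (α i).1 < m ∧ i < α i).card := by
  rw [valWord, count_take_ofFn]
  refine (Finset.card_bij (fun i _ => α i) (fun i hi => ?_) (fun i _ j _ h => α.injective h)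
    fun v hv => ⟨α.symm v, ?_, by simp⟩).symm
  · simpa using hi
  · simpa using hv

lemma count_U_take_valWord (α : Equiv.Perm (Fin n)) (m : ℕ) : ((valWord α).take m).count U =
    (Finset.univ.filter fun i : Fin n => (α i).1 < m ∧ α i ≤ i).card := by
  rw [valWord, count_take_ofFn]
  refine (Finset.card_bij (fun i _ => α i) (fun i hi => ?_) (fun i _ j _ h => α.injective h)
    fun v hv => ⟨α.symm v, ?_, by simp⟩).symm
  · simpa using hi
  · simpa using hv

@[simp] lemma length_posWord (α : Equiv.Perm (Fin n)) : (posWord α).length = n := by simp [posWord]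

@[simp] lemma length_valWord (α : Equiv.Perm (Fin n)) : (valWord α).length = n := by simp [valWord]

/-- The Dyck word whose tracks are `posWord α` and `valWord α`. -/
def toDyck (α : Equiv.Perm (Fin n)) : DyckWord :=
  ofTracks (posWord α) (valWord α) (by simp)
    (by
      rw [← List.take_of_length_le (length_posWord α).le,
        ← List.take_of_length_le (length_valWord α).le, count_U_take_posWord, count_D_take_valWord]
      congr! 3
      simp)
    (by
      intro m _
      rw [count_U_take_posWord, count_D_take_valWord]
      refine Finset.card_le_card fun i hi => ?_
      simp only [Finset.mem_filter, Finset.mem_univ, true_and] at hi ⊢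
      have : i.1 < (α i).1 := hi.2
      exact ⟨by omega, hi.2⟩)

lemma odds_toDyck (α : Equiv.Perm (Fin n)) : odds (toDyck α) = posWord α := odds_ofTracks _ _ _

lemma evens_toDyck (α : Equiv.Perm (Fin n)) : evens (toDyck α) = valWord α := evens_ofTracks _ _ _

lemma semilength_toDyck (α : Equiv.Perm (Fin n)) : (toDyck α).semilength = n := by
  rw [toDyck, semilength_ofTracks, length_posWord]

/-- An element and its image under a monotone bijection between two sets have the same rank. -/
lemma card_filter_lt_eq {α : Equiv.Perm (Fin n)} {p q : Fin n → Prop} [DecidablePred p]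
    [DecidablePred q] (hpq : ∀ i, p i ↔ q (α i)) (h : StrictMonoOn α {i | p i}) {i : Fin n}
    (hi : p i) : (Finset.univ.filter fun j => j < i ∧ p j).card =
      (Finset.univ.filter fun v => v < α i ∧ q v).card := by
  refine Finset.card_bij (fun i _ => α i) (fun j hj => ?_) (fun i _ j _ h => α.injective h)
    fun v hv => ⟨α.symm v, ?_, by simp⟩
  · simp only [Finset.mem_filter, Finset.mem_univ, true_and] at hj ⊢
    exact ⟨h hj.2 hi hj.1, (hpq j).mp hj.2⟩
  · simp only [Finset.mem_filter, Finset.mem_univ, true_and] at hv ⊢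
    have hp : p (α.symm v) := (hpq _).mpr (by simpa using hv.2)
    exact ⟨(h.lt_iff_lt hp hi).mp (by simpa using hv.1), hp⟩

lemma card_filter_lt_lt {q : Fin n → Prop} [DecidablePred q] {u v : Fin n} (hu : q u)
    (huv : u < v) : (Finset.univ.filter fun x => x < u ∧ q x).card <
      (Finset.univ.filter fun x => x < v ∧ q x).card := by
  refine Finset.card_lt_card (Finset.ssubset_iff.mpr ⟨u, by simp, fun x hx => ?_⟩)
  simp only [Finset.mem_insert, Finset.mem_filter, Finset.mem_univ, true_and] at hx ⊢
  rcases hx with rfl | hx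
  · exact ⟨huv, hu⟩
  · exact ⟨hx.1.trans huv, hx.2⟩

lemma apply_eq_apply {α β : Equiv.Perm (Fin n)} {p q : Fin n → Prop}
    (hα : ∀ i, p i ↔ q (α i)) (hβ : ∀ i, p i ↔ q (β i)) (h₁ : StrictMonoOn α {i | p i})
    (h₂ : StrictMonoOn β {i | p i}) {i : Fin n} (hi : p i) : α i = β i := by
  classical
  have h := (card_filter_lt_eq hα h₁ hi).symm.trans (card_filter_lt_eq hβ h₂ hi)
  rcases lt_trichotomy (α i) (β i) with hlt | heq | hlt
  · exact absurd h (card_filter_lt_lt ((hα i).mp hi) hlt).ne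
  · exact heq
  · exact absurd h (card_filter_lt_lt ((hβ i).mp hi) hlt).ne'

lemma toDyck_injOn : Set.InjOn (toDyck (n := n)) {α | NoTriple α} := by
  intro α hα β hβ h
  have hx : ∀ i, i < α i ↔ i < β i := by
    have := congrArg odds h
    simp only [odds_toDyck, posWord, List.ofFn_inj] at this
    intro i
    have := congrFun this i
    grind
  have hy : ∀ v, α.symm v < v ↔ β.symm v < v := by
    have := congrArg evens h
    simp only [evens_toDyck, valWord, List.ofFn_inj] at this
    intro v
    have := congrFun this v
    grind
  have hβ' : ∀ i, i < α i ↔ α.symm (β i) < β i := fun i => by rw [hx, hy]; simp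
  have hβs : StrictMonoOn β {i | i < α i} := by simpa only [hx] using hβ.strictMonoOn_lt
  have hβn : StrictMonoOn β {i | ¬ i < α i} := by
    simpa only [hx, not_lt] using hβ.strictMonoOn_le
  ext1 i
  by_cases hi : i < α i
  · exact apply_eq_apply (p := fun i => i < α i) (q := fun v => α.symm v < v) (by simp) hβ'
      hα.strictMonoOn_lt hβs hi
  · exact apply_eq_apply (p := fun i => ¬ i < α i) (q := fun v => ¬ α.symm v < v) (by simp)
      (fun i => not_congr (hβ' i)) (by simpa only [not_lt] using hα.strictMonoOn_le) hβn hi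

/-- Two finite sets of equal size are matched by a permutation increasing on the first set and on
its complement. -/
lemma exists_perm_strictMonoOn (p q : Fin n → Prop) [DecidablePred p] [DecidablePred q]
    (h : (Finset.univ.filter p).card = (Finset.univ.filter q).card) :
    ∃ α : Equiv.Perm (Fin n), (∀ i, p i ↔ q (α i)) ∧ StrictMonoOn α {i | p i} ∧
      StrictMonoOn α {i | ¬ p i} := by
  have key : ∀ (p q : Fin n → Prop) [DecidablePred p] [DecidablePred q],
      (Finset.univ.filter p).card = (Finset.univ.filter q).card →
      Nonempty ({i // p i} ≃o {i // q i}) := fun p q _ _ h => by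
    have hp : Fintype.card {i // p i} = (Finset.univ.filter p).card := Fintype.card_subtype p
    have hq : Fintype.card {i // q i} = (Finset.univ.filter p).card := by
      rw [h, Fintype.card_subtype q]
    exact ⟨(Fintype.orderIsoFinOfCardEq _ hp).symm.trans (Fintype.orderIsoFinOfCardEq _ hq)⟩
  obtain ⟨e⟩ := key p q h
  obtain ⟨f⟩ := key (fun i => ¬ p i) (fun i => ¬ q i) <| by
    have h₁ := Finset.card_filter_add_card_filter_not (s := Finset.univ) p
    have h₂ := Finset.card_filter_add_card_filter_not (s := Finset.univ) q
    omega
  have hp : ∀ i (hi : p i), Equiv.subtypeCongr e.toEquiv f.toEquiv i = e ⟨i, hi⟩ := fun i hi => by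
    simp [Equiv.subtypeCongr, Equiv.sumCompl_symm_apply_of_pos hi]
  have hn : ∀ i (hi : ¬ p i), Equiv.subtypeCongr e.toEquiv f.toEquiv i = f ⟨i, hi⟩ := fun i hi => by
    simp [Equiv.subtypeCongr, Equiv.sumCompl_symm_apply_of_neg hi]
  refine ⟨Equiv.subtypeCongr e.toEquiv f.toEquiv, fun i => ?_, fun i hi j hj hij => ?_,
    fun i hi j hj hij => ?_⟩
  · by_cases hi : p i
    · rw [hp i hi]
      exact iff_of_true hi (e _).2
    · rw [hn i hi]
      exact iff_of_false hi (f _).2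
  · rw [hp i hi, hp j hj]
    exact e.strictMono (show (⟨i, hi⟩ : {i // p i}) < ⟨j, hj⟩ from hij)
  · rw [hn i hi, hn j hj]
    exact f.strictMono (show (⟨i, hi⟩ : {i // ¬ p i}) < ⟨j, hj⟩ from hij)

lemma exists_toDyck_eq (w : DyckWord) (hw : w.semilength = n) :
    ∃ α : Equiv.Perm (Fin n), NoTriple α ∧ toDyck α = w := by
  obtain ⟨x, hx⟩ : ∃ x : Fin n → DyckStep, odds w = List.ofFn x := by
    subst hw
    exact ⟨fun i => (odds w)[i]'(by simp [length_odds]), List.ext_getElem (by simp [length_odds])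
      (by simp)⟩
  obtain ⟨y, hy⟩ : ∃ y : Fin n → DyckStep, evens w = List.ofFn y := by
    subst hw
    exact ⟨fun i => (evens w)[i]'(by simp [length_evens]), List.ext_getElem (by simp [length_evens])
      (by simp)⟩
  have hbal := count_U_odds w
  rw [hx, hy, ← List.take_of_length_le (List.length_ofFn (f := x)).le,
    ← List.take_of_length_le (List.length_ofFn (f := y)).le, count_take_ofFn, count_take_ofFn]
    at hbal
  simp only [Fin.is_lt, true_and] at hbal
  obtain ⟨α, hxy, h₁, h₂⟩ := exists_perm_strictMonoOn (fun i => x i = U) (fun v => y v = D) hbal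
  have hpre : ∀ i : Fin n, ((evens w).take (i + 1)).count D ≤ ((odds w).take i).count U ∧
      ((odds w).take i).count D < ((evens w).take (i + 1)).count U := fun i => by
    have h := count_take_evens_le w i
    have h₁ := count_D_add_count_U ((evens w).take (i + 1))
    have h₂ := count_D_add_count_U ((odds w).take i)
    have := i.2
    rw [List.length_take, length_evens] at h₁
    rw [List.length_take, length_odds] at h₂
    omega
  simp only [hx, hy, count_take_ofFn] at hpre
  have hU : ∀ i, x i = U → i < α i := fun i hi => by
    by_contra! hle
    have := card_filter_lt_eq (p := fun i => x i = U) (q := fun v => y v = D) hxy h₁ hi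
    have h := (hpre i).1
    simp only [← Fin.lt_def] at h
    rw [this] at h
    refine h.not_gt (Finset.card_lt_card (Finset.ssubset_iff.mpr ⟨α i, by simp, fun v hv => ?_⟩))
    simp only [Finset.mem_insert, Finset.mem_filter, Finset.mem_univ, true_and] at hv ⊢
    rcases hv with rfl | hv
    · exact ⟨Nat.lt_succ_of_le hle, (hxy i).mp hi⟩
    · exact ⟨Nat.lt_succ_of_le (hv.1.le.trans hle), hv.2⟩
  have hD : ∀ i, x i ≠ U → α i ≤ i := fun i hi => by
    by_contra! hlt
    have := card_filter_lt_eq (p := fun i => ¬ x i = U) (q := fun v => ¬ y v = D)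
      (fun i => not_congr (hxy i)) h₂ hi
    have h := (hpre i).2
    simp only [← Fin.lt_def] at h
    have hxD : ∀ j, x j = D ↔ ¬ x j = U := fun j => by cases x j <;> simp
    have hyD : ∀ j, y j = U ↔ ¬ y j = D := fun j => by cases y j <;> simp
    simp only [hxD, hyD] at h
    rw [this] at h
    refine h.not_ge (Finset.card_le_card fun v hv => ?_)
    simp only [Finset.mem_filter, Finset.mem_univ, true_and] at hv ⊢
    have : i.1 < (α i).1 := hlt
    exact ⟨Fin.lt_def.mpr (by omega), hv.2⟩
  have hiff : ∀ i, i < α i ↔ x i = U := fun i => ⟨fun h => by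
    by_contra hi
    exact (hD i hi).not_gt h, hU i⟩
  refine ⟨α, noTriple_of_strictMonoOn h₁ h₂, dyckWord_ext ?_ ?_⟩
  · rw [odds_toDyck, hx, posWord]
    congr 1
    funext i
    simp only [hiff]
    cases x i <;> simp
  · rw [evens_toDyck, hy, valWord]
    congr 1
    funext v
    have : α.symm v < v ↔ y v = D := by
      simpa using (hiff (α.symm v)).trans (hxy (α.symm v))
    simp only [this]
    cases y v <;> simp

lemma card_noTriple {R : Equiv.Perm (Fin n) → Prop} {Q : DyckWord → Prop}
    (h : ∀ α, NoTriple α → (R α ↔ Q (toDyck α))) :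
    Nat.card {α : Equiv.Perm (Fin n) // NoTriple α ∧ R α} =
      Nat.card {w : DyckWord // w.semilength = n ∧ Q w} := by
  refine Nat.card_eq_of_bijective (fun α => ⟨toDyck α.1, semilength_toDyck _,
    (h _ α.2.1).mp α.2.2⟩) ⟨fun α β e => ?_, fun w => ?_⟩
  · exact Subtype.ext (toDyck_injOn α.2.1 β.2.1 (congrArg Subtype.val e))
  · obtain ⟨α, hα, e⟩ := exists_toDyck_eq w.1 w.2.1
    exact ⟨⟨α, hα, (h α hα).mpr (e ▸ w.2.2)⟩, Subtype.ext e⟩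

/-! ### Rectangles in permutations -/

/-- `p` positions followed by `q` positions carrying only smaller values. -/
def HasRect (p q : ℕ) (α : Equiv.Perm (Fin n)) : Prop :=
  ∃ I J : Finset (Fin n), I.card = p ∧ J.card = q ∧ ∀ i ∈ I, ∀ j ∈ J, i < j ∧ α j < α i

/-- A rectangle, with a pair of positions in between whose values lie below and above it. -/
def HasDent (P Q : ℕ) (α : Equiv.Perm (Fin n)) : Prop :=
  ∃ (I J : Finset (Fin n)) (x y : Fin n), I.card = P ∧ J.card = Q ∧ x < y ∧
    (∀ i ∈ I, i < x ∧ α i < α y) ∧ (∀ j ∈ J, y < j ∧ α x < α j) ∧ ∀ i ∈ I, ∀ j ∈ J, α j < α i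

/-- The counting condition expressing that a `p × q` rectangle is cut out at position `a` and
value `b`. -/
def RectAt (p q : ℕ) (α : Equiv.Perm (Fin n)) (a b : ℕ) : Prop :=
  (Finset.univ.filter fun i : Fin n => (α i).1 < b ∧ i < α i).card + p ≤
      (Finset.univ.filter fun i : Fin n => i.1 < a ∧ i < α i).card ∧
    (Finset.univ.filter fun i : Fin n => i.1 < a ∧ α i ≤ i).card + q ≤
      (Finset.univ.filter fun i : Fin n => (α i).1 < b ∧ α i ≤ i).card

lemma RectAt.exists_finset {p q : ℕ} {α : Equiv.Perm (Fin n)} {a b : ℕ} (h : RectAt p q α a b) :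
    ∃ I J : Finset (Fin n), I.card = p ∧ J.card = q ∧
      (∀ i ∈ I, i < α i ∧ i.1 < a ∧ b ≤ (α i).1) ∧
      ∀ j ∈ J, α j ≤ j ∧ a ≤ j.1 ∧ (α j).1 < b := by
  obtain ⟨I, hI, hI'⟩ := Finset.exists_subset_card_eq (n := p)
    ((Nat.le_sub_of_add_le' h.1).trans (Finset.le_card_sdiff _ _))
  obtain ⟨J, hJ, hJ'⟩ := Finset.exists_subset_card_eq (n := q)
    ((Nat.le_sub_of_add_le' h.2).trans (Finset.le_card_sdiff _ _))
  refine ⟨I, J, hI', hJ', fun i hi => ?_, fun j hj => ?_⟩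
  · have := hI hi
    simp only [Finset.mem_sdiff, Finset.mem_filter, Finset.mem_univ, true_and, not_and] at this
    exact ⟨this.1.2, this.1.1, not_lt.mp fun h => this.2 h this.1.2⟩
  · have := hJ hj
    simp only [Finset.mem_sdiff, Finset.mem_filter, Finset.mem_univ, true_and, not_and] at this
    exact ⟨this.1.2, not_lt.mp fun h => this.2 h this.1.2, this.1.1⟩

lemma NoTriple.exists_rectAt {p q : ℕ} {α : Equiv.Perm (Fin n)} (hα : NoTriple α) (hp : 0 < p)
    (hq : 0 < q) {a : ℕ} {I J : Finset (Fin n)} (hI : I.card = p) (hJ : J.card = q)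
    (hIa : ∀ i ∈ I, i.1 < a) (hJa : ∀ j ∈ J, a ≤ j.1) (hIJ : ∀ i ∈ I, ∀ j ∈ J, α j < α i) :
    ∃ b, RectAt p q α a b := by
  obtain ⟨i₀, hi₀, hmin⟩ := I.exists_min_image α (Finset.card_pos.mp (hI ▸ hp))
  obtain ⟨j₀, hj₀⟩ := Finset.card_pos.mp (hJ ▸ hq)
  have hlt : ∀ i ∈ I, ∀ j ∈ J, i < j := fun i hi j hj =>
    Fin.lt_def.mpr ((hIa i hi).trans_le (hJa j hj))
  have hIe : ∀ i ∈ I, i < α i := fun i hi => hα.lt_apply (hlt i hi j₀ hj₀) (hIJ i hi j₀ hj₀)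
  have hJe : ∀ j ∈ J, α j ≤ j := fun j hj => hα.apply_le (hlt i₀ hi₀ j hj) (hIJ i₀ hi₀ j hj)
  refine ⟨α i₀, ?_, ?_⟩
  · rw [← hI, ← Finset.card_union_of_disjoint]
    · refine Finset.card_le_card fun i hi => ?_
      simp only [Finset.mem_union, Finset.mem_filter, Finset.mem_univ, true_and] at hi ⊢
      rcases hi with hi | hi
      · exact ⟨(Fin.lt_def.mp ((hα.strictMonoOn_lt.lt_iff_lt hi.2 (hIe i₀ hi₀)).mp hi.1)).trans
          (hIa i₀ hi₀), hi.2⟩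
      · exact ⟨hIa i hi, hIe i hi⟩
    · refine Finset.disjoint_left.mpr fun i hi hi' => ?_
      simp only [Finset.mem_filter, Finset.mem_univ, true_and] at hi
      exact (hmin i hi').not_gt hi.1
  · rw [← hJ, ← Finset.card_union_of_disjoint]
    · refine Finset.card_le_card fun i hi => ?_
      simp only [Finset.mem_union, Finset.mem_filter, Finset.mem_univ, true_and] at hi ⊢
      rcases hi with hi | hi
      · exact ⟨(Fin.lt_def.mp (hα.strictMonoOn_le hi.2 (hJe j₀ hj₀)
          (Fin.lt_def.mpr (hi.1.trans_le (hJa j₀ hj₀))))).trans (hIJ i₀ hi₀ j₀ hj₀), hi.2⟩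
      · exact ⟨hIJ i₀ hi₀ i hi, hJe i hi⟩
    · refine Finset.disjoint_left.mpr fun i hi hi' => ?_
      simp only [Finset.mem_filter, Finset.mem_univ, true_and] at hi
      exact (hJa i hi').not_gt hi.1

lemma NoTriple.hasRect_iff {p q : ℕ} {α : Equiv.Perm (Fin n)} (hα : NoTriple α) (hp : 0 < p)
    (hq : 0 < q) : HasRect p q α ↔ ∃ a b, RectAt p q α a b := by
  constructor
  · rintro ⟨I, J, hI, hJ, h⟩
    obtain ⟨j₀, hj₀, hmin⟩ := J.exists_min_image id (Finset.card_pos.mp (hJ ▸ hq))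
    exact ⟨j₀, hα.exists_rectAt hp hq hI hJ (fun i hi => (h i hi j₀ hj₀).1)
      (fun j hj => hmin j hj) fun i hi j hj => (h i hi j hj).2⟩
  · rintro ⟨a, b, h⟩
    obtain ⟨I, J, hI, hJ, hI', hJ'⟩ := h.exists_finset
    exact ⟨I, J, hI, hJ, fun i hi j hj => ⟨Fin.lt_def.mpr ((hI' i hi).2.1.trans_le (hJ' j hj).2.1),
      Fin.lt_def.mpr ((hJ' j hj).2.2.trans_le (hI' i hi).2.2)⟩⟩

lemma NoTriple.hasDent_iff {P Q : ℕ} {α : Equiv.Perm (Fin n)} (hα : NoTriple α) (hP : 0 < P)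
    (hQ : 0 < Q) : HasDent P Q α ↔ ∃ (u v : Fin n) (b : ℕ), v.1 = u.1 + 1 ∧ α u ≤ u ∧ v < α v ∧
      RectAt P Q α v b := by
  constructor
  · rintro ⟨I, J, x, y, hI, hJ, hxy, hIx, hJy, hIJ⟩
    obtain ⟨i₀, hi₀⟩ := Finset.card_pos.mp (hI ▸ hP)
    obtain ⟨j₀, hj₀⟩ := Finset.card_pos.mp (hJ ▸ hQ)
    have hx : α x ≤ x := hα.apply_le (hIx i₀ hi₀).1 ((hJy j₀ hj₀).2.trans (hIJ i₀ hi₀ j₀ hj₀))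
    have hy : y < α y := hα.lt_apply (hJy j₀ hj₀).1 ((hIJ i₀ hi₀ j₀ hj₀).trans (hIx i₀ hi₀).2)
    obtain ⟨v, hv, hmin⟩ := (Finset.univ.filter fun v => x < v ∧ v < α v).exists_min_image id
      ⟨y, by simp [hxy, hy]⟩
    simp only [Finset.mem_filter, Finset.mem_univ, true_and, id_eq] at hv hmin
    have hvy := hmin y ⟨hxy, hy⟩
    have hxv : x.1 < v.1 := hv.1
    have hu : v.1 - 1 < n := by omega
    refine ⟨⟨v.1 - 1, hu⟩, v, ?_⟩
    obtain ⟨b, hb⟩ := hα.exists_rectAt hP hQ (a := v) hI hJ (fun i hi => (hIx i hi).1.trans hv.1)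
      (fun j hj => hvy.trans (hJy j hj).1.le) hIJ
    refine ⟨b, by simp only; omega, ?_, hv.2, hb⟩
    by_contra! hlt
    rcases (Fin.le_def.mpr (show x.1 ≤ v.1 - 1 by omega) : x ≤ ⟨v.1 - 1, hu⟩).eq_or_lt with e | hlt'
    · rw [← e] at hlt
      exact hx.not_gt hlt
    · have := Fin.le_def.mp (hmin _ ⟨hlt', hlt⟩)
      simp only at this
      omega
  · rintro ⟨u, v, b, huv, hu, hv, h⟩
    obtain ⟨I, J, hI, hJ, hI', hJ'⟩ := h.exists_finset
    have hIu : ∀ i ∈ I, i < u := fun i hi => by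
      obtain ⟨h₁, h₂, -⟩ := hI' i hi
      refine lt_of_le_of_ne (Fin.le_def.mpr (by omega)) ?_
      rintro rfl
      exact hu.not_gt h₁
    have hJv : ∀ j ∈ J, v < j := fun j hj => by
      obtain ⟨h₁, h₂, -⟩ := hJ' j hj
      refine lt_of_le_of_ne (Fin.le_def.mpr h₂) ?_
      rintro rfl
      exact h₁.not_gt hv
    have huv' : u < v := Fin.lt_def.mpr (by omega)
    exact ⟨I, J, u, v, hI, hJ, huv',
      fun i hi => ⟨hIu i hi, hα.strictMonoOn_lt (hI' i hi).1 hv ((hIu i hi).trans huv')⟩,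
      fun j hj => ⟨hJv j hj, hα.strictMonoOn_le hu (hJ' j hj).1 (huv'.trans (hJv j hj))⟩,
      fun i hi j hj => Fin.lt_def.mpr ((hJ' j hj).2.2.trans_le (hI' i hi).2.2)⟩

lemma rectIn_toDyck_iff {p q : ℕ} (α : Equiv.Perm (Fin n)) :
    RectIn p q (odds (toDyck α)) (evens (toDyck α)) ↔ ∃ a b, RectAt p q α a b := by
  simp only [RectAt, ← count_U_take_posWord, ← count_D_take_posWord, ← count_U_take_valWord,
    ← count_D_take_valWord, odds_toDyck, evens_toDyck]
  constructor
  · rintro ⟨s, t, hs, ht, h⟩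
    refine ⟨s.length, t.length, ?_⟩
    rwa [← List.prefix_iff_eq_take.mp hs, ← List.prefix_iff_eq_take.mp ht]
  · rintro ⟨a, b, h⟩
    exact ⟨_, _, List.take_prefix _ _, List.take_prefix _ _, h⟩

lemma getElem_posWord (α : Equiv.Perm (Fin n)) (i : Fin n) (h : i.1 < (posWord α).length) :
    (posWord α)[i.1] = if i < α i then U else D := by
  simp [posWord]

lemma dentIn_toDyck_iff {P Q : ℕ} (α : Equiv.Perm (Fin n)) :
    DentIn P Q (odds (toDyck α)) (evens (toDyck α)) ↔
      ∃ (u v : Fin n) (b : ℕ), v.1 = u.1 + 1 ∧ α u ≤ u ∧ v < α v ∧ RectAt P Q α v b := by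
  simp only [RectAt, ← count_U_take_posWord, ← count_D_take_posWord, ← count_U_take_valWord,
    ← count_D_take_valWord, odds_toDyck, evens_toDyck]
  constructor
  · rintro ⟨s, r, t, hs, ht, h₁, h₂⟩
    have hl := congrArg List.length hs
    simp only [length_posWord, List.length_append, List.length_cons] at hl
    have hu := getElem_posWord α ⟨s.length, by omega⟩ (by simp; omega)
    have hv := getElem_posWord α ⟨s.length + 1, by omega⟩ (by simp; omega)
    simp only [hs] at hu hv
    refine ⟨⟨s.length, by omega⟩, ⟨s.length + 1, by omega⟩, t.length, rfl, ?_, ?_, ?_⟩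
    · by_contra! h
      simp [if_pos h] at hu
    · by_contra h
      simp [if_neg h] at hv
    · rw [← List.prefix_iff_eq_take.mp ht, hs]
      simp [List.take_append, List.take_of_length_le]
      omega
  · rintro ⟨u, v, b, huv, hu, hv, h₁, h₂⟩
    have hu' := getElem_posWord α u (by simp)
    have hv' := getElem_posWord α v (by simp)
    rw [if_neg hu.not_gt] at hu'
    rw [if_pos hv] at hv'
    simp only [huv] at hv' h₁ h₂
    refine ⟨(posWord α).take u, (posWord α).drop (u + 2), (valWord α).take b, ?_,
      List.take_prefix _ _, ?_, ?_⟩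
    · rw [← hu', ← hv', ← List.drop_eq_getElem_cons, ← List.drop_eq_getElem_cons,
        List.take_append_drop]
    · rw [List.take_succ_eq_append_getElem (by simp), List.count_append, hu'] at h₁
      simpa using h₁
    · rw [List.take_succ_eq_append_getElem (by simp), List.count_append, hu'] at h₂
      simp at h₂
      omega

/-! ### Symmetries -/

lemma NoTriple.inv {α : Equiv.Perm (Fin n)} (h : NoTriple α) : NoTriple α⁻¹ := by
  rintro i j l hij hjl ⟨h₁, h₂⟩
  exact h (α⁻¹ l) (α⁻¹ j) (α⁻¹ i) h₁ h₂ (by simpa using ⟨hij, hjl⟩)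

lemma HasRect.inv {p q : ℕ} {α : Equiv.Perm (Fin n)} (h : HasRect p q α) : HasRect q p α⁻¹ := by
  obtain ⟨I, J, hI, hJ, h⟩ := h
  refine ⟨J.map α.toEmbedding, I.map α.toEmbedding, by simpa, by simpa, ?_⟩
  simp only [Finset.mem_map]
  rintro _ ⟨j, hj, rfl⟩ _ ⟨i, hi, rfl⟩
  simpa using (h i hi j hj).symm

/-- The reverse-complement of a permutation. -/
def revComp (α : Equiv.Perm (Fin n)) : Equiv.Perm (Fin n) :=
  Fin.revPerm.trans (α.trans Fin.revPerm)

lemma revComp_apply (α : Equiv.Perm (Fin n)) (i : Fin n) : revComp α i = (α i.rev).rev := rfl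

lemma revComp_revComp (α : Equiv.Perm (Fin n)) : revComp (revComp α) = α := by
  ext1 i
  simp [revComp_apply]

lemma NoTriple.revComp {α : Equiv.Perm (Fin n)} (h : NoTriple α) : NoTriple (revComp α) := by
  rintro i j l hij hjl ⟨h₁, h₂⟩
  exact h l.rev j.rev i.rev (by simpa) (by simpa) (by
    simp only [revComp_apply, Fin.rev_lt_rev] at h₁ h₂
    exact ⟨h₂, h₁⟩)

lemma HasDent.revComp {P Q : ℕ} {α : Equiv.Perm (Fin n)} (h : HasDent P Q α) :
    HasDent Q P (revComp α) := by
  obtain ⟨I, J, x, y, hI, hJ, hxy, hIx, hJy, h⟩ := h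
  refine ⟨J.map Fin.revPerm.toEmbedding, I.map Fin.revPerm.toEmbedding, y.rev, x.rev, by simpa,
    by simpa, by simpa, ?_, ?_, ?_⟩ <;> simp only [Finset.mem_map]
  · rintro _ ⟨j, hj, rfl⟩
    simpa [revComp_apply] using hJy j hj
  · rintro _ ⟨i, hi, rfl⟩
    simpa [revComp_apply] using hIx i hi
  · rintro _ ⟨j, hj, rfl⟩ _ ⟨i, hi, rfl⟩
    simpa [revComp_apply] using h i hi j hj

lemma card_not_hasRect {p q : ℕ} (hp : 0 < p) (hq : 0 < q) :
    Nat.card {α : Equiv.Perm (Fin n) // NoTriple α ∧ ¬ HasRect p q α} =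
      Nat.card {w : DyckWord // w.semilength = n ∧ RectFree p q w} :=
  card_noTriple fun α hα => by rw [RectFree, rectIn_toDyck_iff, hα.hasRect_iff hp hq]

lemma card_not_hasDent {P Q : ℕ} (hP : 0 < P) (hQ : 0 < Q) :
    Nat.card {α : Equiv.Perm (Fin n) // NoTriple α ∧ ¬ HasDent P Q α} =
      Nat.card {w : DyckWord // w.semilength = n ∧ DentFree P Q w} :=
  card_noTriple fun α hα => by rw [DentFree, dentIn_toDyck_iff, hα.hasDent_iff hP hQ]

lemma gf_rectFree_comm (p q : ℕ) (hp : 0 < p) (hq : 0 < q) :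
    gf (RectFree p q) = gf (RectFree q p) := by
  ext n
  simp only [gf, PowerSeries.coeff_mk]
  rw [← card_not_hasRect hp hq, ← card_not_hasRect hq hp]
  congr 1
  exact Nat.card_congr ⟨fun α => ⟨α.1⁻¹, α.2.1.inv, fun h => α.2.2 (by simpa using h.inv)⟩,
    fun α => ⟨α.1⁻¹, α.2.1.inv, fun h => α.2.2 (by simpa using h.inv)⟩, fun α => by simp,
    fun α => by simp⟩

lemma gf_dentFree_comm (P Q : ℕ) (hP : 0 < P) (hQ : 0 < Q) :
    gf (DentFree P Q) = gf (DentFree Q P) := by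
  ext n
  simp only [gf, PowerSeries.coeff_mk]
  rw [← card_not_hasDent hP hQ, ← card_not_hasDent hQ hP]
  congr 1
  exact Nat.card_congr
    ⟨fun α => ⟨revComp α.1, α.2.1.revComp,
      fun h => α.2.2 (by simpa [revComp_revComp] using h.revComp)⟩,
    fun α => ⟨revComp α.1, α.2.1.revComp,
      fun h => α.2.2 (by simpa [revComp_revComp] using h.revComp)⟩,
    fun α => by simp [revComp_revComp], fun α => by simp [revComp_revComp]⟩

/-! ### Pattern containment -/

lemma avoidsPattern_iff_noTriple {α : Equiv.Perm (Fin n)} :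
    AvoidsPattern α [3, 2, 1] ↔ NoTriple α := by
  constructor
  · rintro h i j l hij hjl ⟨h₁, h₂⟩
    refine h ⟨![i, j, l], ?_, ?_⟩
    · refine Fin.strictMono_iff_lt_succ.mpr fun a => ?_
      fin_cases a
      · exact hij
      · exact hjl
    · intro a b
      fin_cases a <;> fin_cases b <;> simp [h₁, h₂, h₁.trans h₂, h₁.le, h₂.le, (h₁.trans h₂).le]
  · rintro h ⟨f, hf, hw⟩
    exact h (f 0) (f 1) (f 2) (hf (by decide)) (hf (by decide))
      ⟨(hw 2 1).mp (by decide), (hw 1 0).mp (by decide)⟩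

/-- Pattern containment, for a pattern without repeated letters given by a formula. -/
lemma containsPattern_iff {α : Equiv.Perm (Fin n)} {w : List ℕ} {m : ℕ} (hm : w.length = m)
    {g : ℕ → ℕ} (hg : ∀ a (h : a < w.length), w[a] = g a)
    (hinj : ∀ a b, a < m → b < m → g a = g b → a = b) :
    ContainsPattern α w ↔ ∃ f : Fin m → Fin n, StrictMono f ∧
      ∀ a b : Fin m, g a < g b → α (f a) < α (f b) := by
  subst hm
  simp only [ContainsPattern, List.get_eq_getElem, hg]
  refine exists_congr fun f => and_congr_right fun _ => ⟨fun h a b => (h a b).mp,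
    fun h a b => ⟨h a b, fun hα => ?_⟩⟩
  by_contra! hle
  rcases hle.lt_or_eq with hlt | heq
  · exact (h b a hlt).not_gt hα
  · rw [Fin.ext (hinj _ _ a.2 b.2 heq.symm)] at hα
    exact hα.false

lemma length_Ypat {p q : ℕ} : (Ypat (p + q) q).length = p + q := by
  simp [Ypat]

lemma getElem_Ypat {p q a : ℕ} (h : a < (Ypat (p + q) q).length) :
    (Ypat (p + q) q)[a] = if a < p then q + 1 + a else a - p + 1 := by
  simp [Ypat, List.getElem_append]
  split_ifs <;> omega

lemma length_X3pat {P Q : ℕ} : (X3pat (P + Q + 2) (Q + 1)).length = P + Q + 2 := by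
  simp [X3pat]
  omega

lemma getElem_X3pat {P Q a : ℕ} (h : a < (X3pat (P + Q + 2) (Q + 1)).length) :
    (X3pat (P + Q + 2) (Q + 1))[a] = if a < P then Q + 2 + a else if a = P then 1 else
      if a = P + 1 then P + Q + 2 else a - P := by
  have hP : P + Q + 2 - 1 - (Q + 1) = P := by omega
  simp only [X3pat, hP, Nat.add_sub_cancel]
  simp only [List.append_assoc, List.getElem_append, List.length_range',
    List.getElem_range', one_mul]
  grind

lemma NoTriple.containsPattern_Ypat_iff {p q : ℕ} {α : Equiv.Perm (Fin n)} (hα : NoTriple α)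
    (hp : 0 < p) (hq : 0 < q) : ContainsPattern α (Ypat (p + q) q) ↔ HasRect p q α := by
  rw [containsPattern_iff length_Ypat (fun a h => getElem_Ypat h)
    (fun a b _ _ h => by split_ifs at h <;> omega)]
  constructor
  · rintro ⟨f, hf, h⟩
    refine ⟨Finset.univ.image fun a : Fin p => f (a.castAdd q),
      Finset.univ.image fun a : Fin q => f (a.natAdd p), ?_, ?_, ?_⟩
    · rw [Finset.card_image_of_injective, Finset.card_univ, Fintype.card_fin]
      exact hf.injective.comp (Fin.castAdd_injective p q)
    · rw [Finset.card_image_of_injective, Finset.card_univ, Fintype.card_fin]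
      exact hf.injective.comp (Fin.natAdd_injective q p)
    · simp only [Finset.mem_image, Finset.mem_univ, true_and]
      rintro _ ⟨a, rfl⟩ _ ⟨b, rfl⟩
      refine ⟨hf ?_, h _ _ ?_⟩
      · simp [Fin.lt_def]
        omega
      · simp
        omega
  · rintro ⟨I, J, hI, hJ, h⟩
    obtain ⟨i₀, hi₀⟩ := Finset.card_pos.mp (hI ▸ hp)
    obtain ⟨j₀, hj₀⟩ := Finset.card_pos.mp (hJ ▸ hq)
    have hIα : StrictMonoOn α I := hα.strictMonoOn_lt.mono fun i hi =>
      hα.lt_apply (h i hi j₀ hj₀).1 (h i hi j₀ hj₀).2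
    have hJα : StrictMonoOn α J := hα.strictMonoOn_le.mono fun j hj =>
      hα.apply_le (h i₀ hi₀ j hj).1 (h i₀ hi₀ j hj).2
    have mI := I.orderEmbOfFin_mem hI
    have mJ := J.orderEmbOfFin_mem hJ
    have sI := (I.orderEmbOfFin hI).strictMono
    have sJ := (J.orderEmbOfFin hJ).strictMono
    refine ⟨fun a => if ha : a.1 < p then I.orderEmbOfFin hI ⟨a, ha⟩ else
      J.orderEmbOfFin hJ ⟨a - p, by omega⟩, fun a b hab => ?_, fun a b hab => ?_⟩
    · have hab : a.1 < b.1 := hab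
      dsimp only
      split_ifs with ha hb hb
      · exact sI hab
      · exact (h _ (mI _) _ (mJ _)).1
      · omega
      · exact sJ (Fin.lt_def.mpr (by simp only; omega))
    · dsimp only
      split_ifs at hab ⊢ with ha hb hb
      · exact hIα (mI _) (mI _) (sI (Fin.lt_def.mpr (by simp only; omega)))
      · omega
      · exact (h _ (mI _) _ (mJ _)).2
      · exact hJα (mJ _) (mJ _) (sJ (Fin.lt_def.mpr (by simp only; omega)))

lemma NoTriple.containsPattern_X3pat_iff {P Q : ℕ} {α : Equiv.Perm (Fin n)} (hα : NoTriple α)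
    (hP : 0 < P) (hQ : 0 < Q) :
    ContainsPattern α (X3pat (P + Q + 2) (Q + 1)) ↔ HasDent P Q α := by
  rw [containsPattern_iff length_X3pat (fun a h => getElem_X3pat h)
    (fun a b _ _ h => by split_ifs at h <;> omega)]
  constructor
  · rintro ⟨f, hf, h⟩
    have hlt : ∀ a b (ha : a < P + Q + 2) (hb : b < P + Q + 2), a < b → f ⟨a, ha⟩ < f ⟨b, hb⟩ :=
      fun a b _ _ hab => hf hab
    refine ⟨Finset.univ.image fun a : Fin P => f ⟨a, by omega⟩,
      Finset.univ.image fun a : Fin Q => f ⟨P + 2 + a, by omega⟩, f ⟨P, by omega⟩,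
      f ⟨P + 1, by omega⟩, ?_, ?_, hlt _ _ _ _ (by omega), ?_, ?_, ?_⟩
    · rw [Finset.card_image_of_injective, Finset.card_univ, Fintype.card_fin]
      exact fun a b hab => Fin.ext (by simpa using hf.injective hab)
    · rw [Finset.card_image_of_injective, Finset.card_univ, Fintype.card_fin]
      exact fun a b hab => Fin.ext (by simpa using hf.injective hab)
    all_goals simp only [Finset.mem_image, Finset.mem_univ, true_and]
    · rintro _ ⟨a, rfl⟩
      refine ⟨hlt _ _ _ _ (by omega), h _ _ ?_⟩
      simp
      omega
    · rintro _ ⟨a, rfl⟩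
      refine ⟨hlt _ _ _ _ (by omega), h _ _ ?_⟩
      simp only
      split_ifs <;> omega
    · rintro _ ⟨a, rfl⟩ _ ⟨b, rfl⟩
      refine h _ _ ?_
      simp only
      split_ifs <;> omega
  · rintro ⟨I, J, x, y, hI, hJ, hxy, hIx, hJy, h⟩
    obtain ⟨i₀, hi₀⟩ := Finset.card_pos.mp (hI ▸ hP)
    obtain ⟨j₀, hj₀⟩ := Finset.card_pos.mp (hJ ▸ hQ)
    have hIJ : ∀ i ∈ I, ∀ j ∈ J, i < j := fun i hi j hj =>
      (hIx i hi).1.trans (hxy.trans (hJy j hj).1)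
    have hIα : StrictMonoOn α I := hα.strictMonoOn_lt.mono fun i hi =>
      hα.lt_apply (hIJ i hi j₀ hj₀) (h i hi j₀ hj₀)
    have hJα : StrictMonoOn α J := hα.strictMonoOn_le.mono fun j hj =>
      hα.apply_le (hIJ i₀ hi₀ j hj) (h i₀ hi₀ j hj)
    have mI := I.orderEmbOfFin_mem hI
    have mJ := J.orderEmbOfFin_mem hJ
    have sI := (I.orderEmbOfFin hI).strictMono
    have sJ := (J.orderEmbOfFin hJ).strictMono
    have hxI : ∀ i ∈ I, α x < α i := fun i hi => (hJy j₀ hj₀).2.trans (h i hi j₀ hj₀)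
    have hJy' : ∀ j ∈ J, α j < α y := fun j hj => (h i₀ hi₀ j hj).trans (hIx i₀ hi₀).2
    refine ⟨fun a => if ha : a.1 < P then I.orderEmbOfFin hI ⟨a, ha⟩ else if a.1 = P then x else
      if ha' : a.1 = P + 1 then y else J.orderEmbOfFin hJ ⟨a - (P + 2), by omega⟩,
      fun a b hab => ?_, fun a b hab => ?_⟩
    · have hab : a.1 < b.1 := hab
      dsimp only
      split_ifs <;> first
        | omega
        | exact sI hab
        | exact (hIx _ (mI _)).1
        | exact (hIx _ (mI _)).1.trans hxy
        | exact hIJ _ (mI _) _ (mJ _)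
        | exact hxy
        | exact hxy.trans (hJy _ (mJ _)).1
        | exact (hJy _ (mJ _)).1
        | exact sJ (Fin.lt_def.mpr (by simp only; omega))
    · dsimp only
      split_ifs at hab ⊢ <;> first
        | omega
        | exact hIα (mI _) (mI _) (sI (Fin.lt_def.mpr (by simp only; omega)))
        | exact (hIx _ (mI _)).2
        | exact hxI _ (mI _)
        | exact h _ (mI _) _ (mJ _)
        | exact (hxI i₀ hi₀).trans (hIx i₀ hi₀).2
        | exact (hJy _ (mJ _)).2
        | exact hJy' _ (mJ _)
        | exact hJα (mJ _) (mJ _) (sJ (Fin.lt_def.mpr (by simp only; omega)))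

end Permutations

lemma x3_eq_card {P Q : ℕ} (hP : 0 < P) (hQ : 0 < Q) (n : ℕ) : x3 (P + Q + 2) (Q + 1) n =
    Nat.card {w : DyckWord // w.semilength = n ∧ DentFree P Q w} := by
  rw [← card_not_hasDent hP hQ]
  refine Nat.card_congr (Equiv.subtypeEquivRight fun α => ?_)
  rw [avoidsPattern_iff_noTriple]
  exact and_congr_right fun hα => not_congr (hα.containsPattern_X3pat_iff hP hQ)

lemma card_avoids_Ypat {p q : ℕ} (hp : 0 < p) (hq : 0 < q) (n : ℕ) :
    Nat.card {π : Equiv.Perm (Fin n) //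
      AvoidsPattern π [3,2,1] ∧ AvoidsPattern π (Ypat (p + q) q)} =
    Nat.card {w : DyckWord // w.semilength = n ∧ RectFree p q w} := by
  rw [← card_not_hasRect hp hq]
  refine Nat.card_congr (Equiv.subtypeEquivRight fun α => ?_)
  rw [avoidsPattern_iff_noTriple]
  exact and_congr_right fun hα => not_congr (hα.containsPattern_Ypat_iff hp hq)

lemma avoidsPattern_of_lt_length {n : ℕ} (α : Equiv.Perm (Fin n)) {w : List ℕ}
    (h : n < w.length) : AvoidsPattern α w := by
  rintro ⟨f, hf, -⟩
  have := Fintype.card_le_of_injective f hf.injective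
  simp only [Fintype.card_fin] at this
  omega

lemma x3_eq_catalan {P Q n : ℕ} (hn : n < P + Q + 2) :
    x3 (P + Q + 2) (Q + 1) n = catalan n := by
  rw [← DyckWord.card_dyckWord_semilength_eq_catalan, ← Nat.card_eq_fintype_card]
  have h := card_noTriple (n := n) (R := fun _ => True) (Q := fun _ => True) (by simp)
  simp only [and_true] at h
  rw [← h]
  refine Nat.card_congr (Equiv.subtypeEquivRight fun α => ?_)
  rw [avoidsPattern_iff_noTriple]
  exact and_iff_left (avoidsPattern_of_lt_length α (by rwa [length_X3pat]))

end PatternCount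

open PatternCount

/-- For `k ≥ 4` and `2 ≤ d ≤ k−2`: for every `n ≥ k`,
`Σ_{j=0}^{k} (−1)^j C(k−j,j) x_{k,d}^3(n−j) = 0`, and for `0 ≤ n ≤ k−1`,
`x_{k,d}^3(n) = C(2n,n)/(n+1)`, the `n`-th Catalan number; consequently `x_{k,d}^3(n)`
satisfies the same recurrence and initial conditions as `|S_n(321, (d+1)⋯k 1 2 ⋯ d)|`,
so the two sets are equinumerous. -/
theorem x3_recurrence (k d : ℕ) (hk : 4 ≤ k) (hd1 : 2 ≤ d) (hd2 : d ≤ k - 2) :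
    (∀ n : ℕ, k ≤ n →
        ∑ j ∈ Finset.range (k+1), (-1 : ℤ)^j * ((k-j).choose j : ℤ) * (x3 k d (n-j) : ℤ) = 0) ∧
      (∀ n : ℕ, n ≤ k - 1 → x3 k d n = Nat.choose (2*n) n / (n+1)) ∧
      ∀ n : ℕ, x3 k d n =
        Nat.card {π : Equiv.Perm (Fin n) //
          AvoidsPattern π [3,2,1] ∧ AvoidsPattern π (Ypat k d)} := by
  obtain ⟨q, rfl⟩ : ∃ q, d = q + 1 + 1 := ⟨d - 2, by omega⟩
  obtain ⟨p, rfl⟩ : ∃ p, k = p + 1 + (q + 1) + 2 := ⟨k - q - 4, by omega⟩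
  have hx := isConvergent_gf_dentFree gf_dentFree_comm p q
  have hy := isConvergent_gf_rectFree gf_rectFree_comm (p + 1) (q + 1)
  have hgf : gf (DentFree (p + 1) (q + 1)) =
      PowerSeries.mk fun n => (x3 (p + 1 + (q + 1) + 2) (q + 1 + 1) n : ℤ) := by
    simp only [x3_eq_card p.succ_pos q.succ_pos]
    rfl
  refine ⟨fun n hn => ?_, fun n hn => ?_, fun n => ?_⟩
  · refine IsConvergent.sum_eq_zero ?_ (by omega) hn
    rw [← hgf]
    convert hx using 1
    omega
  · rw [x3_eq_catalan (by omega), catalan_eq_centralBinom_div, Nat.centralBinom]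
  · have h := hx.unique (show IsConvergent (p + q + 3) _ by convert hy using 1; omega)
    have h := congrArg (PowerSeries.coeff n) h
    rw [hgf] at h
    simp only [gf, PowerSeries.coeff_mk] at h
    have h := Nat.cast_injective h
    rw [h, show p + 1 + (q + 1) + 2 = p + 1 + 1 + (q + 1 + 1) by ring,
      card_avoids_Ypat (by omega) (by omega)]
end
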